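/- arXiv:1209.0066 — 5 statements merged into one kernel-verified Lean document; each statement's English description precedes it below -/
import Mathlib

section
/- Let α, β ∈ (0, 1/2]. Then the double inequality (π/4)(√(β + (1−β)r'²) + √((1−β) + β r'²)) < E(r) < (π/4)(√(α + (1−α)r'²) + √((1−α) + α r'²)) holds for all r ∈ (0,1) if and only if β ≤ 1/2 − 2√(2(π² − 8))/π² and α ≥ 1/2 − √2/4. -/
open Real Set Filter Topology

/-- The complete elliptic integral of the second kind. -/
noncomputable def ellipticE (r : ℝ) : ℝ :=
  ∫ θ in (0:ℝ)..(π/2), Real.sqrt (1 - r^2 * Real.sin θ ^ 2)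

/-- The complete elliptic integral of the first kind. -/
noncomputable def ellipticK (r : ℝ) : ℝ :=
  ∫ θ in (0:ℝ)..(π/2), (1 - r^2 * Real.sin θ ^ 2) ^ (-(1:ℝ)/2)

noncomputable def qq (m u : ℝ) : ℝ := √(2 - m + 2 * √(1 - m + m^2 * (1 - u) / 4))

lemma two_sqrt {a b : ℝ} (ha : 0 ≤ a) (hb : 0 ≤ b) : √a + √b = √(a + b + 2 * √(a * b)) := by
  symm
  rw [Real.sqrt_eq_iff_mul_self_eq (by positivity) (by positivity), Real.sqrt_mul ha]
  nlinarith [Real.mul_self_sqrt ha, Real.mul_self_sqrt hb]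

lemma two_sqrt_qq {m b : ℝ} (hm : m ∈ Icc (0:ℝ) 1) (hb : b ∈ Icc (0:ℝ) 1) :
    √(b + (1 - b) * (1 - m)) + √((1 - b) + b * (1 - m)) = qq m ((1 - 2 * b)^2) := by
  obtain ⟨h1, h2⟩ := hm
  obtain ⟨h3, h4⟩ := hb
  rw [two_sqrt (by nlinarith [mul_nonneg (sub_nonneg.2 h4) (sub_nonneg.2 h2)])
    (by nlinarith [mul_nonneg h3 (sub_nonneg.2 h2)]), qq]
  congr 1
  have : (b + (1 - b) * (1 - m)) * ((1 - b) + b * (1 - m))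
    = 1 - m + m^2 * (1 - (1 - 2 * b)^2) / 4 := by ring
  rw [this]; ring

lemma qq_cont (m : ℝ) : Continuous (qq m) := by unfold qq; fun_prop

lemma qq_anti {m u v : ℝ} (h : u ≤ v) : qq m v ≤ qq m u := by
  unfold qq
  gcongr

lemma ell_split (r : ℝ) (hr : r ∈ Icc (0:ℝ) 1) :
    ellipticE r = ∫ θ in (0:ℝ)..(π/4), qq (r^2) (cos (2*θ)^2) := by
  have hc : Continuous fun θ : ℝ => √(1 - r^2 * sin θ ^ 2) := by fun_prop
  have hc' : Continuous fun θ : ℝ => √(1 - r^2 * cos θ ^ 2) := by fun_prop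
  have hr2 : r^2 ≤ 1 := by nlinarith [hr.1, hr.2]
  unfold ellipticE
  rw [← intervalIntegral.integral_add_adjacent_intervals (b := π/4)
    (hc.intervalIntegrable _ _) (hc.intervalIntegrable _ _)]
  have h2 : ∫ θ in (π/4)..(π/2), √(1 - r^2 * sin θ ^ 2)
      = ∫ θ in (0:ℝ)..(π/4), √(1 - r^2 * cos θ ^ 2) := by
    have := intervalIntegral.integral_comp_sub_left (a := 0) (b := π/4)
      (fun θ : ℝ => √(1 - r^2 * sin θ ^ 2)) (π/2)
    simp only [Real.sin_pi_div_two_sub] at this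
    rw [this]
    congr 1 <;> ring
  rw [h2, ← intervalIntegral.integral_add (hc.intervalIntegrable _ _) (hc'.intervalIntegrable _ _)]
  congr 1
  ext θ
  have hs := Real.sin_sq_add_cos_sq θ
  have e1 := two_sqrt_qq (m := r^2) (b := cos θ ^ 2) ⟨by positivity, hr2⟩
    ⟨by positivity, by nlinarith [sq_nonneg (sin θ)]⟩
  have e2 : cos θ ^ 2 + (1 - cos θ ^ 2) * (1 - r^2) = 1 - r^2 * sin θ ^ 2 := by
    linear_combination r^2 * hs
  have e3 : (1 - cos θ ^ 2) + cos θ ^ 2 * (1 - r^2) = 1 - r^2 * cos θ ^ 2 := by ring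
  rw [e2, e3] at e1
  rw [e1, Real.cos_two_mul]
  congr 1; ring

lemma ell_split' (r : ℝ) (hr : r ∈ Icc (0:ℝ) 1) :
    ellipticE r = ∫ θ in (0:ℝ)..(π/4), qq (r^2) (sin (2*θ)^2) := by
  rw [ell_split r hr]
  have := intervalIntegral.integral_comp_sub_left (a := 0) (b := π/4)
      (fun θ : ℝ => qq (r^2) (sin (2*θ)^2)) (π/4)
  rw [sub_self, sub_zero] at this
  rw [← this]
  congr 1
  ext θ
  rw [show 2 * (π/4 - θ) = π/2 - 2*θ by ring, Real.sin_pi_div_two_sub]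

lemma qq_concave {m u : ℝ} (hm : m ∈ Icc (0:ℝ) 1) (hu : u ∈ Icc (0:ℝ) 1) :
    qq m u + qq m (1 - u) ≤ 2 * qq m (1/2) ∧
    (0 < m → u = 1 → qq m u + qq m (1 - u) < 2 * qq m (1/2)) := by
  obtain ⟨h1, h2⟩ := hm
  obtain ⟨h3, h4⟩ := hu
  unfold qq
  have g1 : 0 ≤ 1 - m + m^2 * (1 - u) / 4 := by
    have := mul_nonneg (sq_nonneg m) (sub_nonneg.2 h4); linarith
  have g2 : 0 ≤ 1 - m + m^2 * (1 - (1 - u)) / 4 := by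
    have := mul_nonneg (sq_nonneg m) h3; linarith
  have g3 : 0 ≤ 1 - m + m^2 * (1 - 1/2) / 4 := by
    have := sq_nonneg m; linarith
  have s1 := Real.sq_sqrt g1
  have s2 := Real.sq_sqrt g2
  have s3 := Real.sq_sqrt g3
  have n1 := Real.sqrt_nonneg (1 - m + m^2 * (1 - u) / 4)
  have n2 := Real.sqrt_nonneg (1 - m + m^2 * (1 - (1 - u)) / 4)
  have n3 := Real.sqrt_nonneg (1 - m + m^2 * (1 - 1/2) / 4)
  set a := √(1 - m + m^2 * (1 - u) / 4)
  set b := √(1 - m + m^2 * (1 - (1 - u)) / 4)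
  set c := √(1 - m + m^2 * (1 - 1/2) / 4)
  have q1 := Real.sq_sqrt (show 0 ≤ 2 - m + 2 * a by linarith)
  have q2 := Real.sq_sqrt (show 0 ≤ 2 - m + 2 * b by linarith)
  have q3 := Real.sq_sqrt (show 0 ≤ 2 - m + 2 * c by linarith)
  have t3 := Real.sqrt_nonneg (2 - m + 2 * c)
  set A := √(2 - m + 2 * a)
  set B := √(2 - m + 2 * b)
  set C := √(2 - m + 2 * c)
  have key : (a + b)^2 + (a - b)^2 = (2 * c)^2 := by linear_combination 2 * s1 + 2 * s2 - 4 * s3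
  constructor
  · have hab : a + b ≤ 2 * c := abs_le_of_sq_le_sq' (by nlinarith [sq_nonneg (a - b)]) (by linarith) |>.2
    exact abs_le_of_sq_le_sq' (by nlinarith [sq_nonneg (A - B)]) (by linarith) |>.2
  · intro hm hu1
    have hne : a - b ≠ 0 := by
      intro h
      have : a = b := by linarith
      rw [this, hu1] at s1
      rw [hu1] at s2
      nlinarith [pow_pos hm 2]
    have := sq_pos_of_ne_zero hne
    have hab : a + b < 2 * c := abs_lt_of_sq_lt_sq' (by nlinarith) (by linarith) |>.2
    exact abs_lt_of_sq_lt_sq' (by nlinarith [sq_nonneg (A - B)]) (by linarith) |>.2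

lemma ell_lt (r : ℝ) (hr : r ∈ Ioo (0:ℝ) 1) : ellipticE r < π/4 * qq (r^2) (1/2) := by
  have hr' : r ∈ Icc (0:ℝ) 1 := ⟨hr.1.le, hr.2.le⟩
  have hm : r^2 ∈ Icc (0:ℝ) 1 := ⟨by positivity, by nlinarith [hr.1, hr.2]⟩
  have hm0 : 0 < r^2 := pow_pos hr.1 2
  have c1 : Continuous fun θ : ℝ => qq (r^2) (cos (2*θ)^2) := (qq_cont _).comp (by fun_prop)
  have c2 : Continuous fun θ : ℝ => qq (r^2) (sin (2*θ)^2) := (qq_cont _).comp (by fun_prop)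
  have key : ∫ θ in (0:ℝ)..(π/4), (qq (r^2) (cos (2*θ)^2) + qq (r^2) (sin (2*θ)^2))
      < ∫ θ in (0:ℝ)..(π/4), 2 * qq (r^2) (1/2) := by
    have hsin : ∀ θ : ℝ, sin (2*θ)^2 = 1 - cos (2*θ)^2 := fun θ => by
      linarith [Real.sin_sq_add_cos_sq (2*θ)]
    apply intervalIntegral.integral_lt_integral_of_continuousOn_of_le_of_exists_lt
      (by positivity) (c1.add c2).continuousOn continuousOn_const
    · intro θ _
      rw [Pi.add_apply, hsin]
      exact (qq_concave hm ⟨by positivity, Real.cos_sq_le_one _⟩).1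
    · refine ⟨0, ⟨le_rfl, by positivity⟩, ?_⟩
      rw [Pi.add_apply, hsin]
      exact (qq_concave hm ⟨by positivity, Real.cos_sq_le_one _⟩).2 hm0 (by simp)
  rw [intervalIntegral.integral_add (c1.intervalIntegrable _ _) (c2.intervalIntegrable _ _),
    ← ell_split r hr', ← ell_split' r hr', intervalIntegral.integral_const, smul_eq_mul] at key
  linarith

lemma tangent_aux {m w v y z p p0 Q Q0 : ℝ} (hm0 : 0 < m) (hm : m < 1) (hw : 0 ≤ w) (hv : 0 ≤ v)
    (hy : 0 < y) (hz : 0 < z) (hyw : y^2 = 1 + w) (hzv : z^2 = 1 + v)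
    (hp : 0 < p) (hp0 : 0 < p0) (hpp : p^2 = 1 - m + m^2 * w^2 / 4)
    (hpp0 : p0^2 = 1 - m + m^2 * v^2 / 4) (hQ : 0 < Q) (hQ0 : 0 < Q0)
    (hQQ : Q^2 = 2 - m + 2 * p) (hQQ0 : Q0^2 = 2 - m + 2 * p0) (hvw : v < w) :
    v * z / (p0 * Q0) < (w + v) * (y + z) / ((p + p0) * (Q + Q0)) ∧
    (w + v) * (y + z) / ((p + p0) * (Q + Q0)) < w * y / (p * Q) := by
  have hw' : 0 < w := by linarith
  have a1 : v * p < w * p0 := by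
    apply abs_lt_of_sq_lt_sq' _ (by positivity) |>.2
    have : (w * p0)^2 - (v * p)^2 = (1 - m) * ((w - v) * (w + v)) := by
      rw [mul_pow, mul_pow, hpp, hpp0]; ring
    have : 0 < (1 - m) * ((w - v) * (w + v)) :=
      mul_pos (by linarith) (mul_pos (by linarith) (by linarith))
    linarith
  have b1 : m * w / 2 ≤ p := by
    apply abs_le_of_sq_le_sq' _ hp.le |>.2
    rw [hpp]; nlinarith
  have b2 : m * v / 2 ≤ p0 := by
    apply abs_le_of_sq_le_sq' _ hp0.le |>.2
    rw [hpp0]; nlinarith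
  have a2 : p - p0 ≤ m / 2 * (w - v) := by
    by_contra! h
    have h1 : (p - p0) * (p + p0) = m^2/4 * (w - v) * (w + v) := by
      linear_combination hpp - hpp0
    have h2 : m / 2 * (w - v) * (p + p0) < (p - p0) * (p + p0) :=
      mul_lt_mul_of_pos_right h (by linarith)
    have h3 : m / 2 * (w - v) * (m / 2 * (w + v)) ≤ m / 2 * (w - v) * (p + p0) :=
      mul_le_mul_of_nonneg_left (by linarith) (mul_nonneg (by linarith) (by linarith))
    nlinarith
  have a3 : z * Q < y * Q0 := by
    apply abs_lt_of_sq_lt_sq' _ (by positivity) |>.2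
    have e : (y * Q0)^2 - (z * Q)^2
      = 2 * ((1 - m/2) * (w - v) + (p0 - p) + (w * p0 - v * p)) := by
      rw [mul_pow, mul_pow, hyw, hzv, hQQ, hQQ0]; ring
    have : 0 ≤ (1 - m) * (w - v) := mul_nonneg (by linarith) (by linarith)
    nlinarith
  have r1 : v / p0 < (w + v) / (p + p0) := by
    rw [div_lt_div_iff₀ hp0 (by positivity)]; nlinarith
  have r2 : z / Q0 < (y + z) / (Q + Q0) := by
    rw [div_lt_div_iff₀ hQ0 (by positivity)]; nlinarith
  have r3 : (w + v) / (p + p0) < w / p := by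
    rw [div_lt_div_iff₀ (by positivity) hp]; nlinarith
  have r4 : (y + z) / (Q + Q0) < y / Q := by
    rw [div_lt_div_iff₀ (by positivity) hQ]; nlinarith
  rw [← div_mul_div_comm, ← div_mul_div_comm, ← div_mul_div_comm]
  constructor
  · exact mul_lt_mul'' r1 r2 (by positivity) (by positivity)
  · exact mul_lt_mul'' r3 r4 (by positivity) (by positivity)

lemma tangent {m z : ℝ} (hm0 : 0 < m) (hm : m < 1) (hz : 1 ≤ z) :
    ∃ L : ℝ, ∀ y : ℝ, 1 ≤ y → 
      qq m (1 - (z^2-1)^2) + L * (y - z) ≤ qq m (1 - (y^2-1)^2) ∧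
      (z < y → qq m (1 - (z^2-1)^2) + L * (y - z) < qq m (1 - (y^2-1)^2)) := by
  have P : ∀ y : ℝ, ∃ p Q : ℝ, 0 < p ∧ 0 < Q ∧ p^2 = 1 - m + m^2 * (y^2-1)^2/4 ∧
      Q^2 = 2 - m + 2 * p ∧ qq m (1 - (y^2-1)^2) = Q := by
    intro y
    have h1 : 0 < 1 - m + m^2 * (1 - (1 - (y^2-1)^2))/4 := by
      have : 0 ≤ m^2 * (y^2-1)^2 := by positivity
      linarith
    have h2 : 0 < 2 - m + 2 * √(1 - m + m^2 * (1 - (1 - (y^2-1)^2))/4) := by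
      have := Real.sqrt_nonneg (1 - m + m^2 * (1 - (1 - (y^2-1)^2))/4)
      linarith
    refine ⟨√(1 - m + m^2 * (1 - (1 - (y^2-1)^2))/4), _, Real.sqrt_pos.2 h1, Real.sqrt_pos.2 h2,
      ?_, Real.sq_sqrt h2.le, rfl⟩
    rw [Real.sq_sqrt h1.le]; ring
  obtain ⟨p0, Q0, hp0, hQ0, hpp0, hQQ0, e0⟩ := P z
  refine ⟨m^2/2 * ((z^2-1) * z / (p0 * Q0)), fun y hy => ?_⟩
  obtain ⟨p, Q, hp, hQ, hpp, hQQ, e⟩ := P y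
  rw [e0, e]
  have hdiff : Q - Q0 = m^2/2 * (((y^2-1) + (z^2-1)) * (y + z) / ((p + p0) * (Q + Q0))) * (y - z) := by
    have h1 : (Q - Q0) * (Q + Q0) = 2 * (p - p0) := by linear_combination hQQ - hQQ0
    have h2 : (p - p0) * (p + p0) = m^2/4 * ((y^2-1)^2 - (z^2-1)^2) := by
      linear_combination hpp - hpp0
    have h3 : 0 < (p + p0) * (Q + Q0) := by positivity
    field_simp
    linear_combination 2 * (p + p0) * h1 + 4 * h2
  have hw : 0 ≤ y^2 - 1 := by nlinarith
  have hv : 0 ≤ z^2 - 1 := by nlinarith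
  have hmm : 0 < m^2/2 := by positivity
  have strict : z < y → Q0 + m^2/2 * ((z^2-1) * z / (p0 * Q0)) * (y - z) < Q := by
    intro h
    have := (tangent_aux (y := y) (z := z) hm0 hm hw hv (by linarith) (by linarith) (by ring) (by ring) hp hp0 hpp
      hpp0 hQ hQ0 hQQ hQQ0 (by nlinarith)).1
    have := mul_lt_mul_of_pos_right (mul_lt_mul_of_pos_left this hmm) (sub_pos.2 h)
    linarith
  refine ⟨?_, strict⟩
  rcases lt_trichotomy z y with h | h | h
  · exact (strict h).le
  · subst h
    have : Q - Q0 = 0 := by rw [hdiff]; ring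
    rw [sub_self]; linarith
  · have := (tangent_aux (y := z) (z := y) hm0 hm hv hw (by linarith) (by linarith) (by ring) (by ring) hp0 hp hpp0
      hpp hQ0 hQ hQQ0 hQQ (by nlinarith)).2
    have := mul_lt_mul_of_pos_right (mul_lt_mul_of_pos_left this hmm) (sub_pos.2 h)
    have e5 : ((z^2-1) + (y^2-1)) * (z + y) / ((p0 + p) * (Q0 + Q))
      = ((y^2-1) + (z^2-1)) * (y + z) / ((p + p0) * (Q + Q0)) := by
      congr 1 <;> ring
    rw [e5] at this
    linarith

lemma ell_gt (r : ℝ) (hr : r ∈ Ioo (0:ℝ) 1) :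
    π/4 * qq (r^2) (1 - ((4/π)^2-1)^2) < ellipticE r := by
  have hr' : r ∈ Icc (0:ℝ) 1 := ⟨hr.1.le, hr.2.le⟩
  have hm0 : 0 < r^2 := pow_pos hr.1 2
  have hm1 : r^2 < 1 := by nlinarith [hr.1, hr.2]
  have hpi := Real.pi_pos
  have hz : 1 ≤ 4/π := by rw [le_div_iff₀ hpi]; linarith [Real.pi_le_four]
  have hs2 : √2 ^ 2 = 2 := Real.sq_sqrt (by norm_num)
  have hs0 : 0 ≤ √2 := Real.sqrt_nonneg _
  have hz2 : 4/π < √2 := by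
    rw [div_lt_iff₀ hpi]
    have : 1.4 < √2 := Real.lt_sqrt_of_sq_lt (by norm_num)
    nlinarith [Real.pi_gt_three]
  obtain ⟨L, hL⟩ := tangent hm0 hm1 hz
  have c2 : Continuous fun θ : ℝ => qq (r^2) (sin (2*θ)^2) := (qq_cont _).comp (by fun_prop)
  have c1 : Continuous fun θ : ℝ => qq (r^2) (1 - ((4/π)^2-1)^2) + L * (√2 * cos θ - 4/π) := by
    fun_prop
  have hh : ∀ θ : ℝ, sin (2*θ)^2 = 1 - ((√2 * cos θ)^2 - 1)^2 := by
    intro θ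
    have h1 := Real.sin_sq_add_cos_sq (2*θ)
    rw [mul_pow, hs2, ← Real.cos_two_mul]; linarith
  have key : ∫ θ in (0:ℝ)..(π/4), (qq (r^2) (1 - ((4/π)^2-1)^2) + L * (√2 * cos θ - 4/π))
      < ∫ θ in (0:ℝ)..(π/4), qq (r^2) (sin (2*θ)^2) := by
    apply intervalIntegral.integral_lt_integral_of_continuousOn_of_le_of_exists_lt
      (by positivity) c1.continuousOn c2.continuousOn
    · intro θ hθ
      rw [hh]
      refine (hL _ ?_).1
      have : cos (π/4) ≤ cos θ := Real.cos_le_cos_of_nonneg_of_le_pi hθ.1.le (by linarith) hθ.2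
      rw [Real.cos_pi_div_four] at this
      nlinarith
    · refine ⟨0, ⟨le_rfl, by positivity⟩, ?_⟩
      rw [hh]
      refine (hL _ ?_).2 ?_ <;> rw [Real.cos_zero, mul_one] <;> linarith
  rw [← ell_split' r hr'] at key
  have hI : ∫ θ in (0:ℝ)..(π/4), (qq (r^2) (1 - ((4/π)^2-1)^2) + L * (√2 * cos θ - 4/π))
      = π/4 * qq (r^2) (1 - ((4/π)^2-1)^2) := by
    rw [intervalIntegral.integral_add (Continuous.intervalIntegrable (by fun_prop) _ _)
      (Continuous.intervalIntegrable (by fun_prop) _ _), intervalIntegral.integral_const_mul,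
      intervalIntegral.integral_sub (Continuous.intervalIntegrable (by fun_prop) _ _)
      (Continuous.intervalIntegrable (by fun_prop) _ _), intervalIntegral.integral_const_mul,
      integral_cos, intervalIntegral.integral_const, intervalIntegral.integral_const,
      Real.sin_pi_div_four, Real.sin_zero, smul_eq_mul, smul_eq_mul]
    have : √2 * (√2/2 - 0) - (π/4 - 0) * (4/π) = 0 := by
      field_simp; linear_combination π * hs2
    rw [this]; ring
  linarith

lemma ell_cont : Continuous ellipticE := by
  unfold ellipticE
  apply intervalIntegral.continuous_parametric_intervalIntegral_of_continuous'
  fun_prop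

lemma ell_one : ellipticE 1 = 1 := by
  unfold ellipticE
  have : ∫ θ in (0:ℝ)..(π/2), √(1 - 1^2 * sin θ ^ 2) = ∫ θ in (0:ℝ)..(π/2), cos θ := by
    apply intervalIntegral.integral_congr
    intro θ hθ
    rw [uIcc_of_le (by positivity)] at hθ
    have h0 : 0 ≤ cos θ := Real.cos_nonneg_of_mem_Icc ⟨by linarith [hθ.1, Real.pi_pos], hθ.2⟩
    have : 1 - 1^2 * sin θ ^ 2 = cos θ ^ 2 := by linarith [Real.sin_sq_add_cos_sq θ]
    simp only [this]
    exact Real.sqrt_sq h0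
  rw [this, integral_cos]; simp

lemma nec_beta {β : ℝ} (hβ : β ∈ Ioc (0:ℝ) (1/2))
    (h : ∀ r ∈ Ioo (0:ℝ) 1, π/4 * qq (r^2) ((1 - 2*β)^2) < ellipticE r) :
    1 - ((4/π)^2-1)^2 ≤ (1 - 2*β)^2 := by
  have hpi := Real.pi_pos
  have h1 : π/4 * qq (1^2) ((1 - 2*β)^2) ≤ ellipticE 1 := by
    have c : Continuous fun r : ℝ => π/4 * qq (r^2) ((1 - 2*β)^2) := by unfold qq; fun_prop
    refine le_of_tendsto_of_tendsto (b := 𝓝[<] (1:ℝ)) (c.tendsto 1 |>.mono_left nhdsWithin_le_nhds)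
      (ell_cont.tendsto 1 |>.mono_left nhdsWithin_le_nhds) ?_
    filter_upwards [Ioo_mem_nhdsLT (show (0:ℝ) < 1 by norm_num)] with r hr
    exact (h r hr).le
  rw [ell_one] at h1
  have h2 : qq (1^2) ((1 - 2*β)^2) ≤ 4/π := by
    rw [le_div_iff₀ hpi]
    generalize qq (1^2) ((1 - 2*β)^2) = x at h1 ⊢
    linarith
  have g : 0 ≤ 1 - (1:ℝ)^2 + (1^2)^2 * (1 - (1-2*β)^2)/4 := by nlinarith [hβ.1, hβ.2]
  have s := Real.sq_sqrt g
  have n := Real.sqrt_nonneg (1 - (1:ℝ)^2 + (1^2)^2 * (1 - (1-2*β)^2)/4)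
  unfold qq at h2
  rw [Real.sqrt_le_left (by positivity)] at h2
  nlinarith

lemma nec_alpha {c : ℝ} (hc1 : c ≤ 1)
    (h : ∀ r ∈ Ioo (0:ℝ) 1, ellipticE r < π/4 * qq (r^2) c) : c ≤ 1/2 := by
  by_contra! hc
  have hpi := Real.pi_pos
  have hs2 : √2 ^ 2 = 2 := Real.sq_sqrt (by norm_num)
  have hs0 : 0 < √2 := Real.sqrt_pos.2 (by norm_num)
  -- choose k
  obtain ⟨k, hk0, hk1, hk⟩ : ∃ k : ℝ, 0 < k ∧ k < 1 ∧ 8 * k^2 ≤ c - 1/2 := by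
    refine ⟨(c - 1/2)/8, by linarith, by linarith, by nlinarith⟩
  set m := 2 * k / (1 + k) with hmdef
  have hm0 : 0 < m := by positivity
  have hm1 : m < 1 := by rw [hmdef, div_lt_one (by positivity)]; linarith
  set A := 1 - m/2 with hA
  have hA0 : 0 < A := by linarith
  have hmA : m = 2 * A * k := by rw [hA, hmdef]; field_simp; ring
  have hq : ∀ u ∈ Icc (0:ℝ) 1, qq m u = √(2*A) * √(1 + √(1 - k^2 * u)) := by
    intro u hu
    rw [← Real.sqrt_mul (by positivity), qq]
    congr 1
    have : 1 - m + m^2*(1-u)/4 = A^2 * (1 - k^2*u) := by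
      have : m^2 = 4 * A^2 * k^2 := by nth_rw 1 [hmA]; ring
      have h3 : 1 - m + m^2/4 = A^2 := by rw [hA]; ring
      linear_combination h3 - u/4 * this
    rw [this, Real.sqrt_mul (by positivity), Real.sqrt_sq hA0.le]; rw [hA]; ring
  have hup : ∀ u ∈ Icc (0:ℝ) 1, √(1 + √(1 - k^2 * u)) ≤ √2 * (1 - k^2 * u/8) := by
    intro u hu
    have hv : k^2 * u ≤ 1 := by nlinarith [hu.1, hu.2]
    have hv0 : 0 ≤ k^2 * u := mul_nonneg (by positivity) hu.1
    set v := k^2 * u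
    rw [Real.sqrt_le_left (by apply mul_nonneg hs0.le; linarith), mul_pow, hs2]
    have : √(1 - v) ≤ 1 - v/2 := by
      rw [Real.sqrt_le_left (by linarith)]; nlinarith
    nlinarith
  have hlo : ∀ u ∈ Icc (0:ℝ) 1, √2 * (1 - k^2 * u/8 - k^4) ≤ √(1 + √(1 - k^2 * u)) := by
    intro u hu
    have hv : k^2 * u ≤ 1 := by nlinarith [hu.1, hu.2]
    have hv0 : 0 ≤ k^2 * u := mul_nonneg (by positivity) hu.1
    have hvk : (k^2 * u)^2 ≤ k^4 := by
      have : u^2 ≤ 1 := by nlinarith [hu.1, hu.2]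
      have : 0 ≤ k^4 * (1 - u^2) := mul_nonneg (by positivity) (by linarith)
      nlinarith
    set v := k^2 * u
    have h0 : √2 * (1 - v/8 - k^4) ≤ √2 * (1 - v/8 - v^2) :=
      mul_le_mul_of_nonneg_left (by linarith) hs0.le
    refine h0.trans ?_
    apply Real.le_sqrt_of_sq_le
    rw [mul_pow, hs2]
    have : 1 - v/2 - v^2/2 ≤ √(1 - v) := by
      apply Real.le_sqrt_of_sq_le
      have : 0 ≤ v^2 * (1 - v) * (v + 3) := by
        apply mul_nonneg (mul_nonneg (by positivity) (by linarith)) (by linarith)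
      nlinarith
    have h3 : v^3 ≤ v^2 := by nlinarith [sq_nonneg v]
    have h4 : v^4 ≤ v^2 := by nlinarith [sq_nonneg v]
    nlinarith
  have hr : √m ∈ Ioo (0:ℝ) 1 := ⟨Real.sqrt_pos.2 hm0, by
    rw [Real.sqrt_lt' (by norm_num)]; linarith⟩
  have hm2 : √m ^ 2 = m := Real.sq_sqrt hm0.le
  have H := h _ hr
  have e1 := ell_split _ ⟨hr.1.le, hr.2.le⟩
  rw [hm2] at H e1
  have cc : Continuous fun θ : ℝ => qq m (cos (2*θ)^2) := (qq_cont _).comp (by fun_prop)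
  have hA2 : 0 < √(2*A) := Real.sqrt_pos.2 (by positivity)
  have low : ∫ θ in (0:ℝ)..(π/4), √(2*A) * (√2 * (1 - k^2/16 - k^4 - k^2/16 * cos (4*θ)))
      ≤ ∫ θ in (0:ℝ)..(π/4), qq m (cos (2*θ)^2) := by
    apply intervalIntegral.integral_mono_on (by positivity)
      (Continuous.intervalIntegrable (by fun_prop) _ _) (cc.intervalIntegrable _ _)
    intro θ _
    have hu : cos (2*θ)^2 ∈ Icc (0:ℝ) 1 := ⟨by positivity, Real.cos_sq_le_one _⟩
    rw [hq _ hu]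
    apply mul_le_mul_of_nonneg_left _ hA2.le
    refine le_trans (le_of_eq ?_) (hlo _ hu)
    rw [show 4*θ = 2*(2*θ) by ring, Real.cos_two_mul (2*θ)]
    ring
  have hI : ∫ θ in (0:ℝ)..(π/4), √(2*A) * (√2 * (1 - k^2/16 - k^4 - k^2/16 * cos (4*θ)))
      = √(2*A) * (√2 * (π/4 * (1 - k^2/16 - k^4))) := by
    rw [intervalIntegral.integral_const_mul, intervalIntegral.integral_const_mul,
      intervalIntegral.integral_sub (Continuous.intervalIntegrable (by fun_prop) _ _)
      (Continuous.intervalIntegrable (by fun_prop) _ _), intervalIntegral.integral_const_mul,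
      intervalIntegral.integral_const, intervalIntegral.integral_comp_mul_left _ (by norm_num),
      integral_cos, show 4 * (π/4) = π by ring]
    simp
  have hcm : c ∈ Icc (0:ℝ) 1 := ⟨by linarith, hc1⟩
  have f : √(2*A) * (√2 * (π/4 * (1 - k^2/16 - k^4))) < π/4 * (√(2*A) * (√2 * (1 - k^2 * c/8))) := by
    rw [← hI]
    refine (low.trans_eq e1.symm).trans_lt (H.trans_le ?_)
    rw [hq _ hcm]
    have := hup _ hcm
    gcongr
  have f2 : √(2*A) * √2 * (π/4) * (1 - k^2/16 - k^4) < √(2*A) * √2 * (π/4) * (1 - k^2 * c/8) := by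
    linarith
  have f3 := lt_of_mul_lt_mul_left f2 (by positivity)
  have : k^2 * (8 * k^2) ≤ k^2 * (c - 1/2) := mul_le_mul_of_nonneg_left hk (by positivity)
  nlinarith

/-- Theorem 1.1: for α, β ∈ (0, 1/2], the double inequality
(π/4)(√(β+(1−β)r'²) + √((1−β)+βr'²)) < E(r) < (π/4)(√(α+(1−α)r'²) + √((1−α)+αr'²))
holds for all r ∈ (0,1) iff β ≤ 1/2 − 2√(2(π²−8))/π² and α ≥ 1/2 − √2/4. -/
theorem stmt_0 (α β : ℝ) (hα : α ∈ Ioc (0:ℝ) (1/2)) (hβ : β ∈ Ioc (0:ℝ) (1/2)) :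
    (∀ r ∈ Ioo (0:ℝ) 1,
      π/4 * (Real.sqrt (β + (1 - β) * (1 - r^2)) + Real.sqrt ((1 - β) + β * (1 - r^2)))
          < ellipticE r ∧
      ellipticE r <
        π/4 * (Real.sqrt (α + (1 - α) * (1 - r^2)) + Real.sqrt ((1 - α) + α * (1 - r^2)))) ↔
    (β ≤ 1/2 - 2 * Real.sqrt (2 * (π^2 - 8)) / π^2 ∧ 1/2 - Real.sqrt 2 / 4 ≤ α) := by
  have hpi := Real.pi_pos
  have hb : β ≤ 1/2 - 2 * Real.sqrt (2 * (π^2 - 8)) / π^2 ↔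
      1 - ((4/π)^2-1)^2 ≤ (1 - 2*β)^2 := by
    have h8 : 0 ≤ 2 * (π^2 - 8) := by nlinarith [Real.pi_gt_three]
    have e : 1 - ((4/π)^2-1)^2 = (4 * √(2 * (π^2 - 8)) / π^2)^2 := by
      rw [div_pow (4 * _), mul_pow, Real.sq_sqrt h8]; field_simp; ring
    rw [e, sq_le_sq₀ (by positivity) (by linarith [hβ.2])]
    have : 4 * √(2 * (π^2 - 8)) / π^2 = 2 * (2 * √(2 * (π^2 - 8)) / π^2) := by ring
    rw [this]
    constructor <;> intro h <;> linarith
  have ha : 1/2 - Real.sqrt 2 / 4 ≤ α ↔ (1 - 2*α)^2 ≤ 1/2 := by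
    have e : (1/2 : ℝ) = (√2/2)^2 := by
      rw [div_pow, Real.sq_sqrt (by norm_num)]; norm_num
    have : (1 - 2*α)^2 ≤ 1/2 ↔ 1 - 2*α ≤ √2/2 := by
      rw [e, sq_le_sq₀ (by linarith [hα.2]) (by positivity)]
    rw [this]
    constructor <;> intro h <;> linarith
  rw [hb, ha]
  have key : ∀ r ∈ Ioo (0:ℝ) 1, ∀ b ∈ Ioc (0:ℝ) (1/2),
      √(b + (1 - b) * (1 - r^2)) + √((1 - b) + b * (1 - r^2)) = qq (r^2) ((1 - 2 * b)^2) := by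
    intro r hr b hb
    exact two_sqrt_qq ⟨by positivity, by nlinarith [hr.1, hr.2]⟩ ⟨hb.1.le, by linarith [hb.2]⟩
  constructor
  · intro h
    refine ⟨nec_beta hβ fun r hr => ?_, nec_alpha ?_ fun r hr => ?_⟩
    · rw [← key r hr β hβ]; exact (h r hr).1
    · nlinarith [hα.1, hα.2]
    · rw [← key r hr α hα]; exact (h r hr).2
  · rintro ⟨h1, h2⟩ r hr
    rw [key r hr β hβ, key r hr α hα]
    constructor
    · refine lt_of_le_of_lt ?_ (ell_gt r hr)
      have := qq_anti (m := r^2) h1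
      gcongr
    · refine (ell_lt r hr).trans_le ?_
      have := qq_anti (m := r^2) h2
      gcongr
end

section
/- Let t₁, t₂ ∈ [1/2, 1] and p ∈ [1/2, 2]. Then the double inequality 2^{p−2} π (1+r')^{1−2p} ([t₁ + (1−t₁)r']² + [(1−t₁) + t₁ r']²)^p < E(r) < 2^{p−2} π (1+r')^{1−2p} ([t₂ + (1−t₂)r']² + [(1−t₂) + t₂ r']²)^p holds for all r ∈ (0,1) if and only if t₁ ≤ 1/2 + √(1/(4p))/2 and t₂ ≥ 1/2 + √((4/π)^{1/p} − 1)/2. -/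
open Real Set Filter Topology

lemma int_exp (m n : ℕ) : ∫ θ in (0:ℝ)..π, Complex.exp (((2*((m:ℂ)-n)*Complex.I)) * θ) = if m = n then (π:ℂ) else 0 := by
  split_ifs with h
  · subst h; simp
  · have h1 : (m:ℂ) - n ≠ 0 := sub_ne_zero.2 (by exact_mod_cast h)
    rw [integral_exp_mul_complex (by simp [h1])]
    have : Complex.exp (2 * ((m:ℂ)-n) * Complex.I * (π:ℝ)) = 1 := by
      rw [Complex.exp_eq_one_iff]
      exact ⟨(m:ℤ) - n, by push_cast; ring⟩
    rw [this]; simp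

lemma parseval (c : ℕ → ℝ) (hc : Summable fun n => |c n|) :
    HasSum (fun n => c n ^ 2 * π)
      (∫ θ in (0:ℝ)..π, ‖∑' n, (c n : ℂ) * Complex.exp (2 * n * Complex.I * θ)‖ ^ 2) := by
  set e : ℕ → ℝ → ℂ := fun n θ => (c n : ℂ) * Complex.exp (2 * n * Complex.I * θ) with he
  have hn : ∀ n θ, ‖e n θ‖ = |c n| := by
    intro n θ
    have : (2 * n * Complex.I * θ : ℂ) = ((2 * n * θ : ℝ) : ℂ) * Complex.I := by push_cast; ring
    simp only [he]
    rw [norm_mul, this, Complex.norm_exp_ofReal_mul_I]; simp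
  have hs : ∀ θ, Summable fun n => ‖e n θ‖ := by intro θ; simpa [hn] using hc
  have hs2 : ∀ θ, Summable fun n => ‖(starRingEnd ℂ) (e n θ)‖ := by intro θ; simpa [hn] using hc
  have key : ∀ θ, HasSum (fun q : ℕ × ℕ => e q.1 θ * (starRingEnd ℂ) (e q.2 θ))
      (((‖∑' n, e n θ‖ ^ 2 : ℝ)) : ℂ) := by
    intro θ
    have h1 := summable_mul_of_summable_norm (hs θ) (hs2 θ)
    have h2 := tsum_mul_tsum_of_summable_norm (hs θ) (hs2 θ)
    rw [← Complex.conj_tsum, Complex.mul_conj'] at h2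
    rw [Complex.ofReal_pow, h2]
    exact h1.hasSum
  have hprod : Summable fun q : ℕ × ℕ => |c q.1| * |c q.2| := 
    hc.mul_of_nonneg hc (fun _ => abs_nonneg _) (fun _ => abs_nonneg _)
  have hint := intervalIntegral.hasSum_integral_of_dominated_convergence (μ := MeasureTheory.volume) (a := 0) (b := π)
    (F := fun q : ℕ × ℕ => fun θ => e q.1 θ * (starRingEnd ℂ) (e q.2 θ))
    (f := fun θ => (((‖∑' n, e n θ‖ ^ 2 : ℝ)) : ℂ))
    (fun q _ => |c q.1| * |c q.2|)
    (fun q => by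
      apply Continuous.aestronglyMeasurable
      simp only [he]
      fun_prop)
    (fun q => by
      refine Eventually.of_forall fun θ _ => ?_
      rw [norm_mul, RCLike.norm_conj, hn, hn])
    (Eventually.of_forall fun θ _ => hprod)
    (by simp)
    (Eventually.of_forall fun θ _ => key θ)
  rw [intervalIntegral.integral_ofReal] at hint
  have hterm : ∀ q : ℕ × ℕ, (∫ θ in (0:ℝ)..π, e q.1 θ * (starRingEnd ℂ) (e q.2 θ)) =
      ((if q.1 = q.2 then c q.1 * c q.2 * π else 0 : ℝ) : ℂ) := by
    intro q
    have : ∀ θ : ℝ, e q.1 θ * (starRingEnd ℂ) (e q.2 θ) = (c q.1 * c q.2 : ℂ) * 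
        Complex.exp (((2*((q.1:ℂ)-q.2)*Complex.I)) * θ) := by
      intro θ
      simp only [he, map_mul, Complex.conj_ofReal, ← Complex.exp_conj, Complex.conj_I, map_natCast, map_ofNat]
      rw [show (2*((q.1:ℂ)-q.2)*Complex.I) * θ = 2 * q.1 * Complex.I * θ + 2 * q.2 * -Complex.I * θ by ring, Complex.exp_add]
      ring
    simp_rw [this]
    rw [intervalIntegral.integral_const_mul, int_exp]
    split_ifs <;> simp
  simp_rw [hterm] at hint
  rw [Complex.hasSum_ofReal] at hint
  have hinj : Function.Injective (fun n : ℕ => (n, n)) := fun a b h => (Prod.mk.inj h).1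
  rw [← hinj.hasSum_iff] at hint
  · convert hint using 1
    ext n; simp [sq]
  · rintro ⟨m, n⟩ h
    simp only [Set.mem_range, Prod.mk.injEq, not_exists] at h
    rw [if_neg]
    intro hmn
    exact h m ⟨rfl, hmn⟩

noncomputable def JJ (x : ℝ) : ℝ := ∫ θ in (0:ℝ)..(π/2), √(1 + x^2 + 2 * x * cos (2*θ))

lemma JJ_cont : Continuous JJ := by
  unfold JJ
  apply intervalIntegral.continuous_parametric_intervalIntegral_of_continuous' 
  unfold Function.uncurry
  fun_prop

lemma JJ_one : JJ 1 = 2 := by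
  unfold JJ
  have : ∀ θ ∈ uIcc (0:ℝ) (π/2), √(1 + 1^2 + 2 * 1 * cos (2*θ)) = 2 * cos θ := by
    intro θ hθ
    rw [uIcc_of_le (by positivity)] at hθ
    have : 0 ≤ cos θ := cos_nonneg_of_mem_Icc ⟨by linarith [hθ.1, pi_pos], hθ.2⟩
    rw [show 1 + 1^2 + 2 * 1 * cos (2*θ) = (2 * cos θ)^2 by rw [cos_two_mul]; ring]
    exact sqrt_sq (by positivity)
  rw [intervalIntegral.integral_congr this]
  simp

lemma JJ_two (x : ℝ) : ∫ θ in (0:ℝ)..π, √(1 + x^2 + 2 * x * cos (2*θ)) = 2 * JJ x := by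
  have hc : Continuous fun θ => √(1 + x^2 + 2 * x * cos (2*θ)) := by fun_prop
  rw [← intervalIntegral.integral_add_adjacent_intervals (b := π/2) (hc.intervalIntegrable _ _) (hc.intervalIntegrable _ _)]
  have := intervalIntegral.integral_comp_sub_left (fun θ => √(1 + x^2 + 2 * x * cos (2*θ))) π (a := 0) (b := π/2)
  have h2 : ∀ θ : ℝ, cos (2 * (π - θ)) = cos (2*θ) := by
    intro θ
    rw [show 2 * (π - θ) = 2 * π - 2 * θ by ring, cos_two_pi_sub]
  simp only [h2] at this
  rw [show π - π/2 = π/2 by ring, sub_zero] at this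
  rw [← this]; unfold JJ; ring

lemma JJ_series (x : ℝ) (hx0 : 0 ≤ x) (hx : x < 1) :
    HasSum (fun n : ℕ => (Ring.choose (1/2:ℝ) n * x^n)^2 * π) (2 * JJ x) := by
  have hb := Complex.one_add_cpow_hasFPowerSeriesOnBall_zero (a := ((1/2:ℝ):ℂ))
  have hsum : Summable fun n : ℕ => |Ring.choose (1/2:ℝ) n * x^n| := by
    have := (binomialSeries ℂ ((1/2:ℝ):ℂ)).summable_norm_apply (x := (x:ℂ)) (by
      refine Metric.eball_subset_eball hb.r_le ?_
      rw [Metric.mem_eball, edist_zero_right, ← ofReal_norm, Complex.norm_real]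
      simpa [abs_of_nonneg hx0] using hx)
    refine this.congr fun n => ?_
    simp only [binomialSeries_apply, ← Complex.ofReal_choose]
    simp [abs_mul]
  have := parseval _ hsum
  convert this using 1
  rw [← JJ_two]
  apply intervalIntegral.integral_congr
  intro θ _
  dsimp only
  set z : ℂ := x * Complex.exp (2 * Complex.I * θ) with hz
  have hexp : Complex.exp (2 * Complex.I * θ) = Complex.cos (2*θ) + Complex.sin (2*θ) * Complex.I := by
    rw [← Complex.exp_mul_I]; ring_nf
  have hnz : ‖z‖ = x := by
    rw [hz, norm_mul, show (2 * Complex.I * θ : ℂ) = ((2*θ:ℝ):ℂ) * Complex.I by push_cast; ring,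
      Complex.norm_exp_ofReal_mul_I]
    simp [abs_of_nonneg hx0]
  have hs := hb.hasSum (y := z) (by
      rw [Metric.mem_eball, edist_zero_right, ← ofReal_norm, hnz]
      simpa using hx)
  have hs2 : (∑' n : ℕ, ((Ring.choose (1/2:ℝ) n * x^n : ℝ) : ℂ) * Complex.exp (2 * n * Complex.I * θ)) = (1 + z) ^ ((1/2:ℝ):ℂ) := by
    rw [zero_add] at hs
    rw [← hs.tsum_eq]
    congr 1; ext n
    simp only [binomialSeries_apply, ← Complex.ofReal_choose]
    simp only [hz, List.ofFn_const, List.prod_replicate, mul_pow, smul_eq_mul, ← Complex.exp_nat_mul]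
    push_cast
    rw [show (2 * n * Complex.I * θ : ℂ) = n * (2 * Complex.I * θ) by ring]; ring
  rw [hs2, ← norm_pow, ← Complex.cpow_nat_mul]
  rw [show ((2:ℕ):ℂ) * ((1/2:ℝ):ℂ) = 1 by push_cast; norm_num, Complex.cpow_one]
  rw [Complex.norm_def, Complex.normSq_apply]
  congr 1
  rw [hz, hexp, show (2*θ:ℂ) = ((2*θ:ℝ):ℂ) by push_cast; rfl, ← Complex.ofReal_cos, ← Complex.ofReal_sin]
  simp only [Complex.add_re, Complex.add_im, Complex.mul_re, Complex.mul_im, Complex.ofReal_re,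
    Complex.ofReal_im, Complex.I_re, Complex.I_im, Complex.one_re, Complex.one_im]
  linear_combination (-x^2) * sin_sq_add_cos_sq (2*θ)

lemma E_eq (r : ℝ) (hr : r ∈ Ioo (0:ℝ) 1) : 
   (∫ θ in (0:ℝ)..(π/2), Real.sqrt (1 - r^2 * Real.sin θ ^ 2)) = (1 + √(1-r^2))/2 * JJ ((1-√(1-r^2))/(1+√(1-r^2))) := by
  unfold JJ
  have h1 : 0 ≤ 1 - r^2 := by nlinarith [hr.1, hr.2]
  have hs : 0 ≤ √(1-r^2) := sqrt_nonneg _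
  have hs2 := sq_sqrt h1
  set s := √(1-r^2)
  rw [← intervalIntegral.integral_const_mul]
  congr 1; ext θ
  have : (1+s)/2 = √(((1+s)/2)^2) := (sqrt_sq (by positivity)).symm
  rw [this, ← sqrt_mul (by positivity)]
  congr 1
  have : 1 + s ≠ 0 := by positivity
  rw [cos_two_mul']
  field_simp
  rw [cos_sq' θ, show r^2 = 1 - s^2 by linarith]
  ring

lemma F_series (x : ℝ) (hx0 : 0 ≤ x) (hx : x < 1) :
    HasSum (fun n : ℕ => (Ring.choose (1/2:ℝ) n)^2 * x^(2*n)) (2 / π * JJ x) := by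
  have := (JJ_series x hx0 hx).mul_right (1/π)
  rw [show 2 / π * JJ x = 2 * JJ x * (1/π) by ring]
  have e1 : (fun n : ℕ => (Ring.choose (1/2:ℝ) n)^2 * x^(2*n)) =
      fun n : ℕ => (Ring.choose (1 / 2:ℝ) n * x ^ n) ^ 2 * π * (1 / π) := by
    funext n
    field_simp
    ring
  rw [e1]
  exact this

lemma ch (n : ℕ) : Ring.choose (1/2:ℝ) (n+1) = Ring.choose (1/2:ℝ) n * (1/2 - n) / (n+1) := by
  rw [Ring.choose_eq_smul, Ring.choose_eq_smul, descPochhammer_succ_right, Polynomial.smeval_mul]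
  simp [Polynomial.smeval_sub, Polynomial.smeval_X, Polynomial.smeval_natCast, Nat.factorial_succ]
  field_simp

lemma F_R : ∃ R : ℝ → ℝ, (∀ x ∈ Ioo (0:ℝ) 1, 2 / π * JJ x = (1 + x^2/8)^2 + x^6 * R x ∧ 0 < R x) ∧
    MonotoneOn R (Ioo 0 1) := by
  have c0 : Ring.choose (1/2:ℝ) 0 = 1 := by simp
  have c1 : Ring.choose (1/2:ℝ) 1 = 1/2 := by simp
  have c2 : Ring.choose (1/2:ℝ) 2 = -1/8 := by rw [ch 1, c1]; norm_num
  have c3 : Ring.choose (1/2:ℝ) 3 = 1/16 := by rw [ch 2, c2]; norm_num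
  have hs : ∀ x ∈ Ioo (0:ℝ) 1, HasSum (fun n : ℕ => (Ring.choose (1/2:ℝ) (n+3))^2 * x^(2*n))
      ((2 / π * JJ x - (1 + x^2/8)^2)/x^6) := by
    intro x hx
    have h := F_series x hx.1.le hx.2
    rw [← hasSum_nat_add_iff' 3] at h
    have h2 := h.div_const (x^6)
    have hx0 := hx.1.ne'
    have e1 : (fun n : ℕ => (Ring.choose (1/2:ℝ) (n+3))^2 * x^(2*n)) =
        fun n : ℕ => (Ring.choose (1/2:ℝ) (n+3))^2 * x^(2*(n+3)) / x^6 := by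
      funext n
      field_simp
      ring
    have e2 : (1 + x^2/8)^2 = ∑ i ∈ Finset.range 3, Ring.choose (1 / 2:ℝ) i ^ 2 * x ^ (2 * i) := by
      simp only [Finset.sum_range_succ, Finset.sum_range_zero, c0, c1, c2]
      ring
    rw [e1, e2]
    exact h2
  refine ⟨fun x => (2 / π * JJ x - (1 + x^2/8)^2)/x^6, fun x hx => ⟨?_, ?_⟩, ?_⟩
  · have hx0 := hx.1.ne'
    field_simp
    ring
  · have := le_hasSum (hs x hx) 0 (fun n _ => by have := hx.1; positivity)
    simp only [zero_add, c3] at this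
    norm_num at this ⊢
    linarith
  · intro x hx y hy hxy
    refine hasSum_le (fun n => ?_) (hs x hx) (hs y hy)
    have := hx.1.le
    gcongr

lemma F_bounds (x : ℝ) (hx : x ∈ Ioo (0:ℝ) 1) : (1 + x^2/8)^2 < 2 / π * JJ x ∧
    2 / π * JJ x ≤ (1 + x^2/8)^2 + x^6 * (4/π - 81/64) := by
  obtain ⟨R, h1, h2⟩ := F_R
  obtain ⟨e, p⟩ := h1 x hx
  have hx6 : 0 < x^6 := pow_pos hx.1 6
  refine ⟨by rw [e]; nlinarith [mul_pos hx6 p], ?_⟩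
  rw [e]
  have : R x ≤ 4/π - 81/64 := by
    have hc : ContinuousAt (fun y => (2 / π * JJ y - (1 + y^2/8)^2)/y^6) 1 := by
      have := JJ_cont
      refine ContinuousAt.div (by fun_prop) (by fun_prop) (by norm_num)
    have ht : Tendsto (fun y => (2 / π * JJ y - (1 + y^2/8)^2)/y^6) (𝓝[<] 1) (𝓝 (4/π - 81/64)) := by
      have := hc.tendsto.mono_left (nhdsWithin_le_nhds (s := Iio 1))
      convert this using 2
      rw [JJ_one]; ring
    refine ge_of_tendsto ht ?_
    filter_upwards [Ioo_mem_nhdsLT hx.2] with y hy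
    have hy' : y ∈ Ioo (0:ℝ) 1 := ⟨hx.1.trans hy.1, hy.2⟩
    have h3 := h2 hx hy' hy.1.le
    have hy0 := hy'.1.ne'
    rw [(h1 y hy').1]
    convert h3 using 1
    field_simp
    ring
  nlinarith

lemma lower_suff (p u : ℝ) (hp : p ∈ Icc (1/2:ℝ) 2) (hu : u^2 ≤ 1/(4*p)) (x : ℝ) (hx : x ∈ Ioo (0:ℝ) 1) :
    (1 + u^2*x^2)^p < 2 / π * JJ x := by
  refine lt_of_le_of_lt ?_ (F_bounds x hx).1
  have hp0 : 0 < p := by linarith [hp.1]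
  have h1 := one_add_mul_self_le_rpow_one_add (s := x^2/8) (by nlinarith [sq_nonneg x]) (p := 2/p)
    (by rw [le_div_iff₀ hp0]; linarith [hp.2])
  have h2 : 1 + u^2*x^2 ≤ (1 + x^2/8)^(2/p) := by
    refine le_trans ?_ h1
    have : u^2 * x^2 ≤ 1/(4*p) * x^2 := by gcongr
    have e : 2/p*(x^2/8) = 1/(4*p)*x^2 := by field_simp; ring
    linarith
  calc (1 + u^2*x^2)^p ≤ ((1 + x^2/8)^(2/p))^p := by gcongr
    _ = (1 + x^2/8)^2 := by
      rw [← rpow_mul (by positivity), div_mul_cancel₀ _ hp0.ne']; norm_num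

lemma upper_suff (p u : ℝ) (hp : p ∈ Icc (1/2:ℝ) 2) (hu : (4/π)^(1/p) - 1 ≤ u^2) (x : ℝ) (hx : x ∈ Ioo (0:ℝ) 1) :
    2 / π * JJ x < (1 + u^2*x^2)^p := by
  have hp0 : 0 < p := by linarith [hp.1]
  have hpi : 81/64 < 4/π := by
    rw [lt_div_iff₀ pi_pos]; linarith [pi_lt_d2]
  obtain ⟨hh0, hh1⟩ : 0 < x^2 ∧ x^2 < 1 := ⟨pow_pos hx.1 2, by nlinarith [hx.1, hx.2]⟩
  have hF := (F_bounds x hx).2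
  rw [show x^6 = (x^2)^3 by ring] at hF
  set h := x^2
  set b := √(4/π) with hb
  have hb2 : b^2 = 4/π := sq_sqrt (by positivity)
  have hb0 : 0 ≤ b := sqrt_nonneg _
  have hb1 : 9/8 < b := by
    rw [hb]; apply lt_sqrt_of_sq_lt; linarith
  have hA : 2 / π * JJ x < ((1-h) * 1 + h * b)^2 := by
    refine lt_of_le_of_lt hF ?_
    rw [← hb2]
    have e : ((1-h) * 1 + h * b)^2 - ((1 + h/8)^2 + h^3 * (b^2 - 81/64)) =
       h * (1-h) * ((2*(b-1) - 1/4)*(1+h) + ((b-1)^2-1/64) * h) := by ring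
    have : 0 < h * (1-h) * ((2*(b-1) - 1/4)*(1+h) + ((b-1)^2-1/64) * h) := by
      have h1 : 0 < 1 - h := by linarith
      have h2 : 0 < 2*(b-1) - 1/4 := by linarith
      have h3 : 0 < (b-1)^2-1/64 := by nlinarith
      positivity
    linarith
  have hconv := (convexOn_rpow (p := 2/p) (by rw [le_div_iff₀ hp0]; linarith [hp.2])).2
    (show (1:ℝ) ∈ Ici 0 by simp) (show b ∈ Ici 0 from hb0)
    (show 0 ≤ 1 - h by linarith) hh0.le (by ring)
  simp only [smul_eq_mul, one_rpow] at hconv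
  have hbp : b^(2/p) = (4/π)^(1/p) := by
    rw [← hb2, ← rpow_natCast b 2, ← rpow_mul hb0]; congr 1; push_cast; ring
  rw [hbp] at hconv
  have hC : ((1-h) * 1 + h * b)^(2/p) ≤ 1 + u^2*h := by nlinarith
  have hpos : 0 ≤ (1-h) * 1 + h * b := by
    have : 0 ≤ 1 - h := by linarith
    positivity
  refine lt_of_lt_of_le hA ?_
  calc ((1-h) * 1 + h * b)^2 = (((1-h) * 1 + h * b)^(2/p))^p := by
        rw [← rpow_mul hpos, div_mul_cancel₀ _ hp0.ne']; norm_num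
    _ ≤ _ := by gcongr

lemma upper_nec (p u : ℝ) (hp : p ∈ Icc (1/2:ℝ) 2) 
    (H : ∀ x ∈ Ioo (0:ℝ) 1, 2 / π * JJ x < (1 + u^2*x^2)^p) : (4/π)^(1/p) - 1 ≤ u^2 := by
  have hp0 : 0 < p := by linarith [hp.1]
  have h1 : 2/π * JJ 1 ≤ (1 + u^2*1^2)^p := by
    have hc : ContinuousAt (fun x => 2/π * JJ x) 1 := by
      have := JJ_cont
      fun_prop
    have hc2 : ContinuousAt (fun x : ℝ => (1 + u^2*x^2)^p) 1 := 
      ContinuousAt.rpow_const (by fun_prop) (Or.inr hp0.le)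
    refine le_of_tendsto_of_tendsto (hc.tendsto.mono_left (nhdsWithin_le_nhds (s := Iio 1)))
      (hc2.tendsto.mono_left (nhdsWithin_le_nhds (s := Iio 1))) ?_
    filter_upwards [Ioo_mem_nhdsLT one_pos] with y hy using (H y hy).le
  rw [JJ_one, show 2/π*2 = 4/π by ring] at h1
  have : (4/π)^(1/p) ≤ ((1 + u^2*1^2)^p)^(1/p) := by gcongr
  rw [← rpow_mul (by positivity), mul_one_div_cancel hp0.ne', rpow_one] at this
  linarith

lemma lower_nec (p u : ℝ) (hp : p ∈ Icc (1/2:ℝ) 2) 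
    (H : ∀ x ∈ Ioo (0:ℝ) 1, (1 + u^2*x^2)^p < 2 / π * JJ x) : u^2 ≤ 1/(4*p) := by
  have hp0 : 0 < p := by linarith [hp.1]
  suffices h : p * u^2 ≤ 1/4 by
    rw [le_div_iff₀ (by positivity)]; linarith
  have ht : Tendsto (fun x : ℝ => (1/4 + x^2/64 + x^4 * (4/π - 81/64)) * (1 + u^2*x^2)) (𝓝[>] 0) (𝓝 (1/4)) := by
    have : Continuous (fun x : ℝ => (1/4 + x^2/64 + x^4 * (4/π - 81/64)) * (1 + u^2*x^2)) := by fun_prop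
    have := (this.tendsto 0).mono_left (nhdsWithin_le_nhds (s := Ioi 0))
    convert this using 2
    norm_num
  refine ge_of_tendsto ht ?_
  filter_upwards [Ioo_mem_nhdsGT one_pos] with x hx
  have h1 := (H x hx).trans_le (F_bounds x hx).2
  have hv : 0 < 1 + u^2*x^2 := by positivity
  have hx2 : 0 < x^2 := pow_pos hx.1 2
  have h2 : 1 + p * (1 - (1 + u^2*x^2)⁻¹) ≤ (1 + u^2*x^2)^p := by
    rw [rpow_def_of_pos hv]
    have := one_sub_inv_le_log_of_pos hv
    have h3 := add_one_le_exp (Real.log (1 + u^2*x^2) * p)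
    nlinarith
  have h4 : p * (1 - (1 + u^2*x^2)⁻¹) ≤ (1/4 + x^2/64 + x^4 * (4/π - 81/64)) * x^2 := by
    linarith
  have h5 : p * (1 - (1 + u^2*x^2)⁻¹) = p * u^2 / (1 + u^2*x^2) * x^2 := by
    field_simp; ring
  rw [h5] at h4
  have h6 := le_of_mul_le_mul_right h4 hx2
  rwa [div_le_iff₀ hv] at h6

lemma bound_eq (p t s : ℝ) (hs : 0 ≤ s) :
   (2:ℝ)^(p-2) * π * (1 + s)^(1 - 2*p) * ((t + (1 - t) * s)^2 + ((1 - t) + t * s)^2)^p =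
   π/4 * (1 + s) * (1 + (2*t-1)^2 * ((1-s)/(1+s))^2)^p := by
  have h1 : 0 < 1 + s := by linarith
  have e : (t + (1 - t) * s)^2 + ((1 - t) + t * s)^2 = (1+s)^2 / 2 * (1 + (2*t-1)^2 * ((1-s)/(1+s))^2) := by
    field_simp; ring
  rw [e, mul_rpow (by positivity) (by positivity), div_rpow (by positivity) (by positivity),
    rpow_sub (by norm_num), rpow_sub h1, ← rpow_natCast (1+s) 2, ← rpow_mul h1.le]
  push_cast
  rw [rpow_one]
  have a1 : (2:ℝ)^p ≠ 0 := by positivity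
  have a2 : (1+s)^(2*p) ≠ 0 := by positivity
  rw [show (2:ℝ)^(2:ℝ) = 4 by norm_num]
  field_simp

/-- Theorem 1.2: for t₁, t₂ ∈ [1/2, 1] and p ∈ [1/2, 2], the double inequality
2^{p−2}π(1+r')^{1−2p}([t₁+(1−t₁)r']² + [(1−t₁)+t₁r']²)^p < E(r)
  < 2^{p−2}π(1+r')^{1−2p}([t₂+(1−t₂)r']² + [(1−t₂)+t₂r']²)^p
holds for all r ∈ (0,1) iff t₁ ≤ 1/2 + √(1/(4p))/2 and t₂ ≥ 1/2 + √((4/π)^{1/p} − 1)/2. -/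
theorem stmt_1 (t₁ t₂ p : ℝ) (ht₁ : t₁ ∈ Icc (1/2:ℝ) 1) (ht₂ : t₂ ∈ Icc (1/2:ℝ) 1)
    (hp : p ∈ Icc (1/2:ℝ) 2) :
    (∀ r ∈ Ioo (0:ℝ) 1,
      (2:ℝ)^(p-2) * π * (1 + Real.sqrt (1 - r^2))^(1 - 2*p) *
        ((t₁ + (1 - t₁) * Real.sqrt (1 - r^2))^2
          + ((1 - t₁) + t₁ * Real.sqrt (1 - r^2))^2)^p < ellipticE r ∧
      ellipticE r <
        (2:ℝ)^(p-2) * π * (1 + Real.sqrt (1 - r^2))^(1 - 2*p) *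
        ((t₂ + (1 - t₂) * Real.sqrt (1 - r^2))^2
          + ((1 - t₂) + t₂ * Real.sqrt (1 - r^2))^2)^p) ↔
    (t₁ ≤ 1/2 + Real.sqrt (1/(4*p)) / 2 ∧ 1/2 + Real.sqrt ((4/π)^(1/p) - 1) / 2 ≤ t₂) := by
  have hp0 : 0 < p := by linarith [hp.1]
  have k1 : t₁ ≤ 1/2 + Real.sqrt (1/(4*p)) / 2 ↔ (2*t₁-1)^2 ≤ 1/(4*p) := by
    rw [← le_sqrt (by linarith [ht₁.1]) (by positivity)]
    constructor <;> intro h <;> linarith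
  have k2 : 1/2 + Real.sqrt ((4/π)^(1/p) - 1) / 2 ≤ t₂ ↔ (4/π)^(1/p) - 1 ≤ (2*t₂-1)^2 := by
    rw [← sqrt_le_left (by linarith [ht₂.1])]
    constructor <;> intro h <;> linarith
  rw [k1, k2]
  have hE : ∀ r ∈ Ioo (0:ℝ) 1, ellipticE r = π/4 * (1 + √(1-r^2)) * (2/π * JJ ((1-√(1-r^2))/(1+√(1-r^2)))) := by
    intro r hr
    rw [ellipticE, E_eq r hr]
    have := pi_pos
    field_simp
    ring
  have hq : ∀ s : ℝ, 0 ≤ s → 0 < π/4 * (1 + s) := fun s hs => by positivity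
  constructor
  · intro H
    have H' : ∀ x ∈ Ioo (0:ℝ) 1, (1 + (2*t₁-1)^2*x^2)^p < 2/π * JJ x ∧ 2/π * JJ x < (1 + (2*t₂-1)^2*x^2)^p := by
      intro x hx
      have hx1 : 0 < 1 + x := by linarith [hx.1]
      set s := (1-x)/(1+x) with hs
      have hs0 : 0 < s := div_pos (by linarith [hx.2]) hx1
      have hs1 : s < 1 := by rw [hs, div_lt_one hx1]; linarith [hx.1]
      have hr : √(1-s^2) ∈ Ioo (0:ℝ) 1 := by
        refine ⟨sqrt_pos.2 (by nlinarith), ?_⟩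
        rw [sqrt_lt' one_pos]; nlinarith
      have hrs : √(1 - √(1-s^2)^2) = s := by
        rw [sq_sqrt (by nlinarith), sub_sub_cancel, sqrt_sq hs0.le]
      have hxs : (1-s)/(1+s) = x := by rw [hs]; field_simp; ring
      have := H _ hr
      rw [hE _ hr, hrs, bound_eq _ _ _ hs0.le, bound_eq _ _ _ hs0.le, hxs] at this
      exact ⟨lt_of_mul_lt_mul_left this.1 (hq s hs0.le).le, lt_of_mul_lt_mul_left this.2 (hq s hs0.le).le⟩
    exact ⟨lower_nec p _ hp fun x hx => (H' x hx).1, upper_nec p _ hp fun x hx => (H' x hx).2⟩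
  · rintro ⟨h1, h2⟩ r hr
    have hs0 : 0 < √(1-r^2) := sqrt_pos.2 (by nlinarith [hr.1, hr.2])
    have hs1 : √(1-r^2) < 1 := by rw [sqrt_lt' one_pos]; nlinarith [hr.1]
    rw [hE r hr, bound_eq _ _ _ hs0.le, bound_eq _ _ _ hs0.le]
    set s := √(1-r^2)
    have hx : (1-s)/(1+s) ∈ Ioo (0:ℝ) 1 :=
      ⟨div_pos (by linarith) (by linarith), by rw [div_lt_one (by linarith)]; linarith⟩
    exact ⟨mul_lt_mul_of_pos_left (lower_suff p _ hp h1 _ hx) (hq s hs0.le),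
      mul_lt_mul_of_pos_left (upper_suff p _ hp h2 _ hx) (hq s hs0.le)⟩
end

section
/- The function r ↦ (E(r) − r'² K(r))/r² is strictly increasing on (0,1), with limit π/4 as r → 0⁺ and limit 1 as r → 1⁻ (so it maps (0,1) onto (π/4, 1)). -/
open Real Set Filter Topology

lemma aux_pos {r : ℝ} (h0 : 0 ≤ r) (h1 : r < 1) (θ : ℝ) : 0 < 1 - r^2 * Real.sin θ ^ 2 := by
  have := Real.sin_sq_le_one θ
  nlinarith [sq_nonneg (Real.sin θ), sq_nonneg r]

lemma aux_cont {r : ℝ} (h0 : 0 ≤ r) (h1 : r < 1) :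
    Continuous (fun θ : ℝ => Real.cos θ ^ 2 / Real.sqrt (1 - r^2 * Real.sin θ ^ 2)) := by
  refine Continuous.div (by fun_prop) (by fun_prop) ?_
  intro θ
  exact (Real.sqrt_pos.2 (aux_pos h0 h1 θ)).ne'

lemma aux_eq {r : ℝ} (hr : r ∈ Ioo (0:ℝ) 1) :
    (ellipticE r - (1 - r^2) * ellipticK r) / r^2 =
      ∫ θ in (0:ℝ)..(π/2), Real.cos θ ^ 2 / Real.sqrt (1 - r^2 * Real.sin θ ^ 2) := by
  have hp := aux_pos hr.1.le hr.2
  have hK : ellipticK r = ∫ θ in (0:ℝ)..(π/2), (Real.sqrt (1 - r^2 * Real.sin θ ^ 2))⁻¹ := by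
    unfold ellipticK
    congr 1
    ext θ
    rw [neg_div, Real.rpow_neg (hp θ).le, Real.sqrt_eq_rpow]
  have hc : Continuous (fun θ : ℝ => (Real.sqrt (1 - r^2 * Real.sin θ ^ 2))⁻¹) := by
    refine Continuous.inv₀ (by fun_prop) ?_
    intro θ
    exact (Real.sqrt_pos.2 (hp θ)).ne'
  have hc2 : Continuous (fun θ : ℝ => Real.sqrt (1 - r^2 * Real.sin θ ^ 2)) := by fun_prop
  have hc3 : Continuous (fun θ : ℝ => (1 - r^2) * (Real.sqrt (1 - r^2 * Real.sin θ ^ 2))⁻¹) :=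
    continuous_const.mul hc
  rw [hK, ellipticE, ← intervalIntegral.integral_const_mul,
    ← intervalIntegral.integral_sub (hc2.intervalIntegrable _ _)
      (hc3.intervalIntegrable _ _), ← intervalIntegral.integral_div]
  congr 1
  ext θ
  have h1 := Real.sqrt_pos.2 (hp θ)
  have h2 := Real.sq_sqrt (hp θ).le
  have hr0 : r ≠ 0 := hr.1.ne'
  set S := Real.sqrt (1 - r^2 * Real.sin θ ^ 2) with hS
  have h3 := Real.sin_sq_add_cos_sq θ
  have h4 : S ^ 2 - (1 - r ^ 2) = r ^ 2 * Real.cos θ ^ 2 := by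
    rw [h2]; linear_combination (-r^2) * h3
  field_simp
  linear_combination h4

lemma aux_tendsto {a : ℝ} (ha : a ∈ Icc (0:ℝ) 1) :
    Tendsto (fun r : ℝ => (ellipticE r - (1 - r^2) * ellipticK r) / r^2)
      (𝓝[Ioo 0 1] a)
      (𝓝 (∫ θ in (0:ℝ)..(π/2), Real.cos θ ^ 2 / Real.sqrt (1 - a^2 * Real.sin θ ^ 2))) := by
  have hev : ∀ᶠ r in 𝓝[Ioo 0 1] a, r ∈ Ioo (0:ℝ) 1 := self_mem_nhdsWithin
  have key : Tendsto (fun r : ℝ => ∫ θ in (0:ℝ)..(π/2),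
      Real.cos θ ^ 2 / Real.sqrt (1 - r^2 * Real.sin θ ^ 2)) (𝓝[Ioo 0 1] a)
      (𝓝 (∫ θ in (0:ℝ)..(π/2), Real.cos θ ^ 2 / Real.sqrt (1 - a^2 * Real.sin θ ^ 2))) := by
    apply intervalIntegral.tendsto_integral_filter_of_dominated_convergence (fun _ => (1:ℝ))
    · filter_upwards [hev] with r hr
      exact (aux_cont hr.1.le hr.2).aestronglyMeasurable
    · filter_upwards [hev] with r hr
      refine Eventually.of_forall fun θ _ => ?_
      have hp := aux_pos hr.1.le hr.2 θ
      have h1 := Real.sqrt_pos.2 hp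
      rw [Real.norm_of_nonneg (by positivity), div_le_one h1]
      apply Real.le_sqrt_of_sq_le
      have h3 := Real.sin_sq_add_cos_sq θ
      have h5 : r ^ 2 ≤ 1 := by nlinarith [hr.1, hr.2]
      have h6 := Real.cos_sq_le_one θ
      nlinarith [sq_nonneg (Real.sin θ), sq_nonneg (Real.cos θ)]
    · exact intervalIntegrable_const
    · refine Eventually.of_forall fun θ _ => ?_
      by_cases hc : Real.cos θ = 0
      · simp only [hc, ne_eq, OfNat.ofNat_ne_zero, not_false_eq_true, zero_pow, zero_div]
        exact tendsto_const_nhds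
      have hpos : 0 < 1 - a^2 * Real.sin θ ^ 2 := by
        have h3 := Real.sin_sq_add_cos_sq θ
        have h5 : a ^ 2 ≤ 1 := by nlinarith [ha.1, ha.2]
        have : 0 < Real.cos θ ^ 2 := by positivity
        nlinarith [sq_nonneg (Real.sin θ)]
      have : ContinuousAt (fun r : ℝ => Real.cos θ ^ 2 / Real.sqrt (1 - r^2 * Real.sin θ ^ 2)) a :=
        ContinuousAt.div (by fun_prop) (by fun_prop) (Real.sqrt_pos.2 hpos).ne'
      exact this.tendsto.mono_left nhdsWithin_le_nhds
  refine key.congr' ?_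
  filter_upwards [hev] with r hr
  exact (aux_eq hr).symm

/-- Lemma 2.2(1): r ↦ (E(r) − r'²K(r))/r² is strictly increasing from (0,1) onto (π/4, 1). -/
theorem stmt_2 :
    StrictMonoOn (fun r : ℝ => (ellipticE r - (1 - r^2) * ellipticK r) / r^2) (Ioo 0 1) ∧
    Tendsto (fun r : ℝ => (ellipticE r - (1 - r^2) * ellipticK r) / r^2)
      (𝓝[>] 0) (𝓝 (π/4)) ∧
    Tendsto (fun r : ℝ => (ellipticE r - (1 - r^2) * ellipticK r) / r^2)
      (𝓝[<] 1) (𝓝 1) := by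
  refine ⟨?_, ?_, ?_⟩
  · intro r hr s hs hrs
    simp only
    rw [aux_eq hr, aux_eq hs]
    have hlt : ∀ θ : ℝ, Real.cos θ ^ 2 / Real.sqrt (1 - r^2 * Real.sin θ ^ 2) ≤
        Real.cos θ ^ 2 / Real.sqrt (1 - s^2 * Real.sin θ ^ 2) := by
      intro θ
      have := Real.sqrt_pos.2 (aux_pos hs.1.le hs.2 θ)
      have := hr.1
      gcongr
    apply intervalIntegral.integral_lt_integral_of_continuousOn_of_le_of_exists_lt
      (by positivity) (aux_cont hr.1.le hr.2).continuousOn (aux_cont hs.1.le hs.2).continuousOn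
      (fun θ _ => hlt θ)
    refine ⟨π/4, ⟨by positivity, by linarith [Real.pi_pos]⟩, ?_⟩
    have h1 := Real.sqrt_pos.2 (aux_pos hs.1.le hs.2 (π/4))
    have h2 : 0 < Real.cos (π/4) := by rw [Real.cos_pi_div_four]; positivity
    have h3 : 0 < Real.sin (π/4) := by rw [Real.sin_pi_div_four]; positivity
    have h4 := hr.1
    refine div_lt_div_of_pos_left (by positivity) h1 ?_
    apply Real.sqrt_lt_sqrt (aux_pos hs.1.le hs.2 (π/4)).le
    gcongr
  · have h := aux_tendsto (a := 0) (by simp)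
    rw [nhdsWithin_Ioo_eq_nhdsGT one_pos] at h
    convert h using 2
    simp [integral_cos_sq]
    ring
  · have h := aux_tendsto (a := 1) (by simp)
    rw [nhdsWithin_Ioo_eq_nhdsLT one_pos] at h
    convert h using 2
    have : ∫ θ in (0:ℝ)..(π/2), Real.cos θ ^ 2 / Real.sqrt (1 - 1^2 * Real.sin θ ^ 2) =
        ∫ θ in (0:ℝ)..(π/2), Real.cos θ := by
      apply intervalIntegral.integral_congr
      intro θ hθ
      rw [uIcc_of_le (by positivity)] at hθ
      have h0 : 0 ≤ Real.cos θ := Real.cos_nonneg_of_mem_Icc ⟨by linarith [hθ.1, Real.pi_pos], hθ.2⟩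
      have : 1 - 1^2 * Real.sin θ ^ 2 = Real.cos θ ^ 2 := by
        linear_combination -Real.sin_sq_add_cos_sq θ
      simp only
      rw [this, Real.sqrt_sq h0, sq, mul_self_div_self]
    rw [this]
    simp
end

section
/- The function r ↦ r'^{3/4} (K(r) − E(r))/r² is strictly decreasing on (0,1), with limit π/4 as r → 0⁺ and limit 0 as r → 1⁻ (so it maps (0,1) onto (0, π/4)). -/
open Real Set Filter Topology

noncomputable def Gm (m : ℝ) : ℝ :=
  ∫ θ in (0:ℝ)..(π/2), Real.sin θ ^ 2 * (1 - m * Real.sin θ ^ 2) ^ (-(1:ℝ)/2)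

lemma delta_ge {m m1 : ℝ} (h : m ≤ m1) (h1 : 0 ≤ m1) (θ : ℝ) :
    1 - m1 ≤ 1 - m * Real.sin θ ^ 2 := by
  have h2 := Real.sin_sq_le_one θ
  have h3 := sq_nonneg (Real.sin θ)
  nlinarith

lemma delta_pos {m : ℝ} (h : m < 1) (θ : ℝ) : 0 < 1 - m * Real.sin θ ^ 2 := by
  have h2 := Real.sin_sq_le_one θ
  have h3 := sq_nonneg (Real.sin θ)
  by_cases h0 : 0 ≤ m
  · nlinarith
  · nlinarith

lemma cont_pow {m : ℝ} (h : m < 1) (p : ℝ) :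
    Continuous (fun θ : ℝ => (1 - m * Real.sin θ ^ 2) ^ p) := by
  refine Continuous.rpow_const (by fun_prop) (fun θ => Or.inl (delta_pos h θ).ne')

lemma Gm_deriv {m : ℝ} (h : m < 1) :
    HasDerivAt Gm (∫ θ in (0:ℝ)..(π/2),
      (1/2) * Real.sin θ ^ 4 * (1 - m * Real.sin θ ^ 2) ^ (-(3:ℝ)/2)) m := by
  obtain ⟨m1, hm1, hm2⟩ := exists_between (max_lt h zero_lt_one)
  have hm : m < m1 := lt_of_le_of_lt (le_max_left _ _) hm1
  have h0 : 0 < m1 := lt_of_le_of_lt (le_max_right _ _) hm1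
  refine (intervalIntegral.hasDerivAt_integral_of_dominated_loc_of_deriv_le
    (μ := MeasureTheory.volume)
    (F := fun m θ => Real.sin θ ^ 2 * (1 - m * Real.sin θ ^ 2) ^ (-(1:ℝ)/2))
    (F' := fun m θ => (1/2) * Real.sin θ ^ 4 * (1 - m * Real.sin θ ^ 2) ^ (-(3:ℝ)/2))
    (bound := fun _ => (1 - m1) ^ (-(3:ℝ)/2))
    (s := Iio m1) (Iio_mem_nhds hm) ?_ ?_ ?_ ?_ ?_ ?_).2
  · filter_upwards [Iio_mem_nhds h] with x hx
    exact (Continuous.mul (by fun_prop) (cont_pow hx _)).aestronglyMeasurable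
  · exact (Continuous.mul (by fun_prop) (cont_pow h _)).intervalIntegrable _ _
  · exact (Continuous.mul (by fun_prop) (cont_pow h _)).aestronglyMeasurable
  · refine Eventually.of_forall fun θ _ x hx => ?_
    have hp := delta_pos (lt_trans hx hm2) θ
    have h1 := delta_ge (le_of_lt hx) h0.le θ
    have h2 := Real.sin_sq_le_one θ
    have h3 := sq_nonneg (Real.sin θ)
    have h4 : (1 - x * Real.sin θ ^ 2) ^ (-(3:ℝ)/2) ≤ (1 - m1) ^ (-(3:ℝ)/2) :=
      Real.rpow_le_rpow_of_nonpos (by linarith) h1 (by norm_num)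
    have h5 : 0 ≤ (1 - x * Real.sin θ ^ 2) ^ (-(3:ℝ)/2) := Real.rpow_nonneg hp.le _
    rw [Real.norm_of_nonneg (by positivity)]
    have h6 : (1/2) * Real.sin θ ^ 4 ≤ 1 := by nlinarith
    nlinarith
  · exact continuous_const.intervalIntegrable _ _
  · refine Eventually.of_forall fun θ _ x hx => ?_
    have hp := delta_pos (lt_trans hx hm2) θ
    have hd : HasDerivAt (fun x : ℝ => 1 - x * Real.sin θ ^ 2) (-(1 * Real.sin θ ^ 2)) x :=
      ((hasDerivAt_id x).mul_const _).const_sub 1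
    have := (hd.rpow_const (p := -(1:ℝ)/2) (Or.inl hp.ne')).const_mul (Real.sin θ ^ 2)
    refine HasDerivAt.congr_deriv this ?_
    rw [show -(1:ℝ)/2 - 1 = -(3:ℝ)/2 by norm_num]
    ring

lemma rpow_half {d : ℝ} (hd : 0 < d) : d ^ (-(1:ℝ)/2) = d * d ^ (-(3:ℝ)/2) := by
  rw [show -(1:ℝ)/2 = 1 + -(3:ℝ)/2 by norm_num, Real.rpow_add hd, Real.rpow_one]

lemma key {m : ℝ} (h0 : 0 < m) (h : m < 1) :
    (1 - m) * (∫ θ in (0:ℝ)..(π/2),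
      (1/2) * Real.sin θ ^ 4 * (1 - m * Real.sin θ ^ 2) ^ (-(3:ℝ)/2)) - 3/8 * Gm m < 0 := by
  have hI : ∫ θ in (0:ℝ)..(π/2), (1/8) * (3 * Real.sin θ ^ 2 - (4 + 2 * m) * Real.sin θ ^ 4
      + 3 * m * Real.sin θ ^ 6) * (1 - m * Real.sin θ ^ 2) ^ (-(3:ℝ)/2) = 0 := by
    have := intervalIntegral.integral_eq_sub_of_hasDerivAt (a := 0) (b := π/2)
      (f := fun θ => (1/8) * (Real.sin θ ^ 3 * Real.cos θ) *
        (1 - m * Real.sin θ ^ 2) ^ (-(1:ℝ)/2))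
      (f' := fun θ => (1/8) * (3 * Real.sin θ ^ 2 - (4 + 2 * m) * Real.sin θ ^ 4
      + 3 * m * Real.sin θ ^ 6) * (1 - m * Real.sin θ ^ 2) ^ (-(3:ℝ)/2)) ?_ ?_
    · rw [this]; simp
    · intro θ _
      have hp := delta_pos h θ
      have hd : HasDerivAt (fun θ : ℝ => 1 - m * Real.sin θ ^ 2)
          (-(m * (2 * Real.sin θ * Real.cos θ))) θ := by
        have := (((Real.hasDerivAt_sin θ).pow 2).const_mul m).const_sub 1
        refine HasDerivAt.congr_deriv this ?_
        simp
      have h1 := hd.rpow_const (p := -(1:ℝ)/2) (Or.inl hp.ne')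
      have h2 := ((((Real.hasDerivAt_sin θ).pow 3).mul (Real.hasDerivAt_cos θ)).const_mul (1/8))
      have h3 := h2.mul h1
      refine HasDerivAt.congr_deriv h3 ?_
      rw [show -(1:ℝ)/2 - 1 = -(3:ℝ)/2 by norm_num, rpow_half hp]
      simp only [Pi.mul_apply, Pi.pow_apply]
      generalize (1 - m * Real.sin θ ^ 2) ^ (-(3:ℝ)/2) = D
      have hc := Real.cos_sq θ
      have hc : Real.cos θ ^ 2 = 1 - Real.sin θ ^ 2 := by
        linarith [Real.sin_sq_add_cos_sq θ]
      push_cast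
      generalize Real.sin θ = s at *
      generalize Real.cos θ = c at *
      norm_num
      linear_combination (exp := 1) ((1/8) * 3 * s^2 * (1 - m * s^2) * D + (1/8) * s^4 * m * D) * hc
    · exact (Continuous.mul (by fun_prop) (cont_pow h _)).intervalIntegrable _ _
  have hpos : 0 < ∫ θ in (0:ℝ)..(π/2), (3/8) * m * (Real.sin θ ^ 4 * Real.cos θ ^ 2) *
      (1 - m * Real.sin θ ^ 2) ^ (-(3:ℝ)/2) := by
    refine intervalIntegral.intervalIntegral_pos_of_pos_on ?_ ?_ (by positivity)
    · exact (Continuous.mul (by fun_prop) (cont_pow h _)).intervalIntegrable _ _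
    · intro θ hθ
      have h1 := Real.sin_pos_of_pos_of_lt_pi hθ.1 (by linarith [hθ.2, Real.pi_pos])
      have h2 := Real.cos_pos_of_mem_Ioo ⟨by linarith [hθ.1, Real.pi_pos], hθ.2⟩
      have h3 := Real.rpow_pos_of_pos (delta_pos h θ) (-(3:ℝ)/2)
      positivity
  have hs : (1 - m) * (∫ θ in (0:ℝ)..(π/2),
      (1/2) * Real.sin θ ^ 4 * (1 - m * Real.sin θ ^ 2) ^ (-(3:ℝ)/2)) - 3/8 * Gm m
      + (∫ θ in (0:ℝ)..(π/2), (1/8) * (3 * Real.sin θ ^ 2 - (4 + 2 * m) * Real.sin θ ^ 4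
      + 3 * m * Real.sin θ ^ 6) * (1 - m * Real.sin θ ^ 2) ^ (-(3:ℝ)/2))
      = - ∫ θ in (0:ℝ)..(π/2), (3/8) * m * (Real.sin θ ^ 4 * Real.cos θ ^ 2) *
      (1 - m * Real.sin θ ^ 2) ^ (-(3:ℝ)/2) := by
    unfold Gm
    rw [← intervalIntegral.integral_const_mul, ← intervalIntegral.integral_const_mul,
      ← intervalIntegral.integral_sub, ← intervalIntegral.integral_add,
      ← intervalIntegral.integral_neg]
    · congr 1
      ext θ
      rw [rpow_half (delta_pos h θ)]
      have hc : Real.cos θ ^ 2 = 1 - Real.sin θ ^ 2 := by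
        linarith [Real.sin_sq_add_cos_sq θ]
      rw [hc]
      ring
    · exact Continuous.intervalIntegrable (Continuous.sub
        (continuous_const.mul (Continuous.mul (by fun_prop) (cont_pow h _)))
        (continuous_const.mul (Continuous.mul (by fun_prop) (cont_pow h _)))) _ _
    · exact (Continuous.mul (by fun_prop) (cont_pow h _)).intervalIntegrable _ _
    · exact (continuous_const.mul
        (Continuous.mul (by fun_prop) (cont_pow h _))).intervalIntegrable _ _
    · exact (continuous_const.mul
        (Continuous.mul (by fun_prop) (cont_pow h _))).intervalIntegrable _ _
  linarith

lemma F_anti : StrictAntiOn (fun m : ℝ => (1 - m) ^ ((3:ℝ)/8) * Gm m) (Ioo 0 1) := by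
  have hder : ∀ m ∈ Ioo (0:ℝ) 1, HasDerivAt (fun m : ℝ => (1 - m) ^ ((3:ℝ)/8) * Gm m)
      ((1 - m) ^ (-(5:ℝ)/8) * ((1 - m) * (∫ θ in (0:ℝ)..(π/2),
      (1/2) * Real.sin θ ^ 4 * (1 - m * Real.sin θ ^ 2) ^ (-(3:ℝ)/2)) - 3/8 * Gm m)) m := by
    intro m hm
    have hp : 0 < 1 - m := by linarith [hm.2]
    have h1 := (((hasDerivAt_id m).const_sub 1).rpow_const (p := (3:ℝ)/8) (Or.inl hp.ne')).mul
      (Gm_deriv hm.2)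
    refine HasDerivAt.congr_deriv h1 ?_
    simp only [id]
    have : (1 - m) ^ ((3:ℝ)/8) = (1 - m) * (1 - m) ^ (-(5:ℝ)/8) := by
      rw [show (3:ℝ)/8 = 1 + -(5:ℝ)/8 by norm_num, Real.rpow_add hp, Real.rpow_one]
    rw [this, show (3:ℝ)/8 - 1 = -(5:ℝ)/8 by norm_num]
    ring
  refine strictAntiOn_of_deriv_neg (convex_Ioo 0 1)
    (fun m hm => (hder m hm).continuousAt.continuousWithinAt) ?_
  intro m hm
  rw [interior_Ioo] at hm
  rw [(hder m hm).deriv]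
  exact mul_neg_of_pos_of_neg (Real.rpow_pos_of_pos (by linarith [hm.2]) _) (key hm.1 hm.2)

lemma KE {r : ℝ} (h : r ^ 2 < 1) : ellipticK r - ellipticE r = r ^ 2 * Gm (r ^ 2) := by
  unfold ellipticK ellipticE Gm
  have hs : Continuous (fun θ : ℝ => Real.sqrt (1 - r^2 * Real.sin θ ^ 2)) := by fun_prop
  rw [← intervalIntegral.integral_sub ((cont_pow h _).intervalIntegrable _ _)
    (hs.intervalIntegrable _ _), ← intervalIntegral.integral_const_mul]
  congr 1
  ext θ
  have hp := delta_pos h θ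
  have : Real.sqrt (1 - r^2 * Real.sin θ ^ 2) = (1 - r^2 * Real.sin θ ^ 2) *
      (1 - r^2 * Real.sin θ ^ 2) ^ (-(1:ℝ)/2) := by
    rw [Real.sqrt_eq_rpow]
    nth_rewrite 2 [← Real.rpow_one (1 - r^2 * Real.sin θ ^ 2)]
    rw [← Real.rpow_add hp]
    norm_num
  rw [this]
  ring

lemma f_eq {r : ℝ} (h0 : r ≠ 0) (h : r ^ 2 < 1) :
    Real.sqrt (1 - r^2) ^ ((3:ℝ)/4) * (ellipticK r - ellipticE r) / r^2
      = (1 - r ^ 2) ^ ((3:ℝ)/8) * Gm (r ^ 2) := by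
  rw [KE h, Real.sqrt_eq_rpow, ← Real.rpow_mul (by linarith)]
  norm_num
  field_simp

lemma Gm_zero : Gm 0 = π / 4 := by
  unfold Gm
  simp [integral_sin_sq]
  ring

lemma Gm_nonneg {m : ℝ} (h : m < 1) : 0 ≤ Gm m := by
  refine intervalIntegral.integral_nonneg (by positivity) fun θ _ => ?_
  have := Real.rpow_nonneg (delta_pos h θ).le (-(1:ℝ)/2)
  positivity

lemma Gm_le {m : ℝ} (h0 : 1/2 ≤ m) (h : m < 1) :
    (1 - m) ^ ((3:ℝ)/8) * Gm m ≤ 4 * √2 * (1 - m) ^ ((1:ℝ)/8) := by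
  obtain ⟨y, hy, hy2⟩ : ∃ y : ℝ, 0 < y ∧ y ^ 2 = 1 - m :=
    ⟨√(1 - m), Real.sqrt_pos.2 (by linarith), Real.sq_sqrt (by linarith)⟩
  have hy1 : y ≤ 1 := by nlinarith
  have hcos : ∀ θ ∈ Icc 0 (π/2), 0 ≤ Real.cos θ := fun θ hθ =>
    Real.cos_nonneg_of_mem_Icc ⟨by linarith [hθ.1, Real.pi_pos], hθ.2⟩
  have hcont : ContinuousOn (fun θ : ℝ => 2 / √y * (Real.sin θ / √(y + Real.cos θ)))
      (uIcc 0 (π/2)) := by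
    rw [uIcc_of_le (by positivity)]
    refine ContinuousOn.mul continuousOn_const (ContinuousOn.div (by fun_prop) (by fun_prop) ?_)
    intro θ hθ
    have := hcos θ hθ
    positivity
  have hint : ∫ θ in (0:ℝ)..(π/2), 2 / √y * (Real.sin θ / √(y + Real.cos θ))
      = 2 / √y * (2 * √(y + 1) - 2 * √y) := by
    rw [intervalIntegral.integral_eq_sub_of_hasDerivAt
      (f := fun θ => 2 / √y * (- (2 * √(y + Real.cos θ)))) ?_ hcont.intervalIntegrable]
    · simp; ring
    · intro θ hθ
      rw [uIcc_of_le (by positivity)] at hθ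
      have hc := hcos θ hθ
      have hp : 0 < y + Real.cos θ := by positivity
      have := ((((Real.hasDerivAt_cos θ).const_add y).sqrt hp.ne').const_mul 2).neg.const_mul
        (2 / √y)
      refine HasDerivAt.congr_deriv this ?_
      field_simp
  have hG : Gm m ≤ 2 / √y * (2 * √(y + 1) - 2 * √y) := by
    rw [← hint]
    refine intervalIntegral.integral_mono_on (by positivity)
      ((Continuous.mul (by fun_prop) (cont_pow h _)).intervalIntegrable _ _)
      hcont.intervalIntegrable ?_
    intro θ hθ
    have hc := hcos θ hθ
    have hs := Real.sin_nonneg_of_nonneg_of_le_pi hθ.1 (by linarith [hθ.2, Real.pi_pos])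
    have hs1 := Real.sin_le_one θ
    have hsc := Real.sin_sq_add_cos_sq θ
    have hp := delta_pos h θ
    have hp2 : 0 < y + Real.cos θ := by positivity
    have hb : (y * (y + Real.cos θ)) / 4 ≤ 1 - m * Real.sin θ ^ 2 := by
      have : Real.sin θ ^ 2 = 1 - Real.cos θ ^ 2 := by linarith
      rw [this]
      nlinarith [sq_nonneg (y - Real.cos θ), sq_nonneg (Real.cos θ)]
    have e1 : (1 - m * Real.sin θ ^ 2) ^ (-(1:ℝ)/2) ≤ 2 / √y * (1 / √(y + Real.cos θ)) := by
      calc (1 - m * Real.sin θ ^ 2) ^ (-(1:ℝ)/2)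
          ≤ ((y * (y + Real.cos θ)) / 4) ^ (-(1:ℝ)/2) :=
            Real.rpow_le_rpow_of_nonpos (by positivity) hb (by norm_num)
        _ = 2 / √y * (1 / √(y + Real.cos θ)) := by
            rw [neg_div, Real.rpow_neg (by positivity), ← Real.sqrt_eq_rpow,
              Real.sqrt_div (by positivity), Real.sqrt_mul hy.le,
              show √(4:ℝ) = 2 by rw [show (4:ℝ) = 2 ^ 2 by norm_num]; simp]
            field_simp
    have e0 : 0 ≤ (1 - m * Real.sin θ ^ 2) ^ (-(1:ℝ)/2) := Real.rpow_nonneg hp.le _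
    calc Real.sin θ ^ 2 * (1 - m * Real.sin θ ^ 2) ^ (-(1:ℝ)/2)
        ≤ Real.sin θ * (1 - m * Real.sin θ ^ 2) ^ (-(1:ℝ)/2) := by
          apply mul_le_mul_of_nonneg_right _ e0
          nlinarith
      _ ≤ Real.sin θ * (2 / √y * (1 / √(y + Real.cos θ))) :=
          mul_le_mul_of_nonneg_left e1 hs
      _ = _ := by ring
  have hG2 : Gm m ≤ 4 * √2 / √y := by
    refine hG.trans ?_
    have : √(y + 1) ≤ √2 := Real.sqrt_le_sqrt (by linarith)
    have h3 : 0 < √y := Real.sqrt_pos.2 hy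
    rw [div_mul_eq_mul_div]
    refine div_le_div_of_nonneg_right ?_ h3.le
    linarith
  have hyy : √y = (1 - m) ^ ((1:ℝ)/4) := by
    rw [← hy2, ← Real.rpow_natCast, ← Real.rpow_mul hy.le, Real.sqrt_eq_rpow]
    norm_num
  have hm : 0 < 1 - m := by linarith
  calc (1 - m) ^ ((3:ℝ)/8) * Gm m ≤ (1 - m) ^ ((3:ℝ)/8) * (4 * √2 / √y) :=
        mul_le_mul_of_nonneg_left hG2 (Real.rpow_nonneg hm.le _)
    _ = 4 * √2 * (1 - m) ^ ((1:ℝ)/8) := by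
        rw [hyy, show (3:ℝ)/8 = 1/4 + 1/8 by norm_num, Real.rpow_add hm]
        have := Real.rpow_pos_of_pos hm ((1:ℝ)/4)
        field_simp

/-- Lemma 2.2(5): r ↦ r'^{3/4}(K(r) − E(r))/r² is strictly decreasing from (0,1) onto (0, π/4). -/
theorem stmt_6 :
    StrictAntiOn
      (fun r : ℝ => Real.sqrt (1 - r^2) ^ ((3:ℝ)/4) * (ellipticK r - ellipticE r) / r^2)
      (Ioo 0 1) ∧
    Tendsto (fun r : ℝ => Real.sqrt (1 - r^2) ^ ((3:ℝ)/4) * (ellipticK r - ellipticE r) / r^2)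
      (𝓝[>] 0) (𝓝 (π/4)) ∧
    Tendsto (fun r : ℝ => Real.sqrt (1 - r^2) ^ ((3:ℝ)/4) * (ellipticK r - ellipticE r) / r^2)
      (𝓝[<] 1) (𝓝 0) := by
  refine ⟨?_, ?_, ?_⟩
  · intro a ha b hb hab
    have ha2 : a ^ 2 < 1 := by nlinarith [ha.1, ha.2]
    have hb2 : b ^ 2 < 1 := by nlinarith [hb.1, hb.2]
    simp only
    rw [f_eq ha.1.ne' ha2, f_eq hb.1.ne' hb2]
    exact F_anti ⟨by have := ha.1; positivity, ha2⟩ ⟨by have := hb.1; positivity, hb2⟩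
      (by nlinarith [ha.1, hb.1])
  · have hc : ContinuousAt (fun r : ℝ => (1 - r ^ 2) ^ ((3:ℝ)/8) * Gm (r ^ 2)) 0 := by
      refine ContinuousAt.mul (ContinuousAt.rpow_const (by fun_prop) (Or.inl (by norm_num))) ?_
      have h1 : ContinuousAt Gm ((0:ℝ) ^ 2) := (Gm_deriv (by norm_num)).continuousAt
      exact ContinuousAt.comp (f := fun r : ℝ => r ^ 2) h1 (by fun_prop)
    have ht := hc.tendsto.mono_left (nhdsWithin_le_nhds (s := Ioi 0))
    simp only [ne_eq, OfNat.ofNat_ne_zero, not_false_eq_true, zero_pow, sub_zero,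
      Real.one_rpow, one_mul, Gm_zero] at ht
    refine ht.congr' ?_
    filter_upwards [Ioo_mem_nhdsGT (zero_lt_one' ℝ)] with r hr
    exact (f_eq hr.1.ne' (by nlinarith [hr.1, hr.2])).symm
  · have hc : ContinuousAt (fun r : ℝ => 4 * √2 * (1 - r ^ 2) ^ ((1:ℝ)/8)) 1 :=
      ContinuousAt.mul continuousAt_const
        (ContinuousAt.rpow_const (by fun_prop) (Or.inr (by norm_num)))
    have ht := hc.tendsto.mono_left (nhdsWithin_le_nhds (s := Iio 1))
    have hz : 4 * √2 * (1 - (1:ℝ) ^ 2) ^ ((1:ℝ)/8) = 0 := by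
      rw [one_pow, sub_self, Real.zero_rpow (by norm_num), mul_zero]
    rw [hz] at ht
    refine squeeze_zero' ?_ ?_ ht
    · filter_upwards [Ioo_mem_nhdsLT (show (3/4:ℝ) < 1 by norm_num)] with r hr
      have h2 : r ^ 2 < 1 := by nlinarith [hr.1, hr.2]
      rw [f_eq (by have := hr.1; intro h; linarith) h2]
      exact mul_nonneg (Real.rpow_nonneg (by linarith) _) (Gm_nonneg h2)
    · filter_upwards [Ioo_mem_nhdsLT (show (3/4:ℝ) < 1 by norm_num)] with r hr
      have h2 : r ^ 2 < 1 := by nlinarith [hr.1, hr.2]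
      rw [f_eq (by have := hr.1; intro h; linarith) h2]
      exact Gm_le (by nlinarith [hr.1]) h2
end

section
/- The function r ↦ [4(2E(r) − r'² K(r))² − π²]/r² is strictly increasing on (0,1), with limit π²/2 as r → 0⁺ and limit 16 − π² as r → 1⁻ (so it maps (0,1) onto (π²/2, 16 − π²)). -/
open Real Set Filter Topology

noncomputable def auxC (x : ℝ) : ℝ :=
  ∫ θ in (0:ℝ)..(π/2), Real.cos θ ^ 2 / (1 + Real.sqrt (1 - x * Real.sin θ ^ 2))

theorem auxC_den (x θ : ℝ) : 0 < 1 + Real.sqrt (1 - x * Real.sin θ ^ 2) := by positivity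

theorem auxC_cont2 : Continuous (fun p : ℝ × ℝ =>
    Real.cos p.2 ^ 2 / (1 + Real.sqrt (1 - p.1 * Real.sin p.2 ^ 2))) := by
  apply Continuous.div
  · fun_prop
  · fun_prop
  · intro p
    exact (auxC_den _ _).ne'

theorem auxC_cont1 (x : ℝ) : Continuous (fun θ : ℝ =>
    Real.cos θ ^ 2 / (1 + Real.sqrt (1 - x * Real.sin θ ^ 2))) := by
  apply Continuous.div
  · fun_prop
  · fun_prop
  · intro p
    exact (auxC_den _ _).ne'

theorem auxC_cont : Continuous auxC := by
  unfold auxC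
  exact intervalIntegral.continuous_parametric_intervalIntegral_of_continuous'
    (f := fun x θ => Real.cos θ ^ 2 / (1 + Real.sqrt (1 - x * Real.sin θ ^ 2))) auxC_cont2 _ _

theorem auxC_zero : auxC 0 = π / 8 := by
  have h : auxC 0 = ∫ θ in (0:ℝ)..(π/2), Real.cos θ ^ 2 * (1/2) := by
    unfold auxC
    congr 1
    ext θ
    norm_num
    ring
  rw [h, intervalIntegral.integral_mul_const, integral_cos_sq]
  simp
  ring

theorem auxC_one : auxC 1 = 2 - π / 2 := by
  have hpi := Real.pi_pos
  unfold auxC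
  have h := intervalIntegral.integral_eq_sub_of_hasDerivAt (a := 0) (b := π/2)
    (f := fun θ : ℝ => Real.sin θ - θ + Real.sin θ / (1 + Real.cos θ))
    (f' := fun θ : ℝ => Real.cos θ ^ 2 / (1 + Real.sqrt (1 - 1 * Real.sin θ ^ 2))) ?_
    ((auxC_cont1 1).intervalIntegrable _ _)
  · rw [h]
    simp
    ring
  · intro θ hθ
    rw [uIcc_of_le (by positivity)] at hθ
    have hc : 0 ≤ Real.cos θ := Real.cos_nonneg_of_mem_Icc ⟨by linarith [hθ.1], hθ.2⟩
    have hs : 1 - 1 * Real.sin θ ^ 2 = Real.cos θ ^ 2 := by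
      have := Real.sin_sq_add_cos_sq θ
      linarith
    rw [hs, Real.sqrt_sq hc]
    have hne : 1 + Real.cos θ ≠ 0 := by positivity
    have hd := ((Real.hasDerivAt_sin θ).sub (hasDerivAt_id θ)).add
      ((Real.hasDerivAt_sin θ).div ((Real.hasDerivAt_cos θ).const_add 1) hne)
    refine hd.congr_deriv ?_
    have hsc := Real.sin_sq_add_cos_sq θ
    field_simp
    linear_combination hsc

theorem auxC_mono {x y : ℝ} (hx : 0 ≤ x) (hxy : x < y) (hy : y ≤ 1) : auxC x < auxC y := by
  have hpi := Real.pi_pos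
  have hle : ∀ θ : ℝ, Real.sqrt (1 - y * Real.sin θ ^ 2) ≤ Real.sqrt (1 - x * Real.sin θ ^ 2) := by
    intro θ
    apply Real.sqrt_le_sqrt
    nlinarith [sq_nonneg (Real.sin θ)]
  unfold auxC
  apply intervalIntegral.integral_lt_integral_of_continuousOn_of_le_of_exists_lt (by positivity)
    (auxC_cont1 x).continuousOn (auxC_cont1 y).continuousOn
  · intro θ _
    have h1 := auxC_den x θ
    have h2 := auxC_den y θ
    have := hle θ
    gcongr
  · refine ⟨π/4, ⟨by positivity, by linarith⟩, ?_⟩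
    have h2 := auxC_den y (π/4)
    have hs : Real.sin (π/4) ^ 2 = 1/2 := by
      rw [Real.sin_pi_div_four, div_pow, Real.sq_sqrt (by norm_num)]
      norm_num
    have hc : 0 < Real.cos (π/4) ^ 2 := by
      rw [Real.cos_pi_div_four]
      positivity
    have : Real.sqrt (1 - y * Real.sin (π/4) ^ 2) < Real.sqrt (1 - x * Real.sin (π/4) ^ 2) := by
      apply Real.sqrt_lt_sqrt
      · rw [hs]
        linarith
      · rw [hs]
        linarith
    gcongr

theorem auxC_pos {x : ℝ} (hx : 0 ≤ x) (hx1 : x ≤ 1) : 0 < auxC x := by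
  have h0 : 0 < auxC 0 := by
    rw [auxC_zero]
    positivity
  rcases hx.eq_or_lt with h | h
  · rwa [← h]
  · exact h0.trans (auxC_mono le_rfl h hx1)

theorem aux_key {r : ℝ} (hr : r ∈ Ioo (0:ℝ) 1) :
    2 * ellipticE r - (1 - r^2) * ellipticK r = π / 2 + r ^ 2 * auxC (r ^ 2) := by
  have hD : ∀ θ : ℝ, 0 < 1 - r^2 * Real.sin θ ^ 2 := by
    intro θ
    have h1 := Real.sin_sq_le_one θ
    have h2 : r ^ 2 < 1 := by nlinarith [hr.1, hr.2]
    nlinarith [sq_nonneg (Real.sin θ), sq_nonneg r]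
  have hK : ellipticK r = ∫ θ in (0:ℝ)..(π/2), 1 / Real.sqrt (1 - r^2 * Real.sin θ ^ 2) := by
    unfold ellipticK
    congr 1
    ext θ
    rw [show (-(1:ℝ)/2) = -(1/2) by norm_num, Real.rpow_neg (hD θ).le, ← Real.sqrt_eq_rpow, one_div]
  have cE : Continuous (fun θ : ℝ => Real.sqrt (1 - r^2 * Real.sin θ ^ 2)) := by fun_prop
  have cK : Continuous (fun θ : ℝ => 1 / Real.sqrt (1 - r^2 * Real.sin θ ^ 2)) :=
    continuous_const.div cE (fun θ => (Real.sqrt_pos.2 (hD θ)).ne')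
  have cC := auxC_cont1 (r^2)
  have h := intervalIntegral.integral_eq_sub_of_hasDerivAt (a := 0) (b := π/2)
    (f := fun θ : ℝ => r^2 * (Real.sin θ * Real.cos θ) / (1 + Real.sqrt (1 - r^2 * Real.sin θ ^ 2)))
    (f' := fun θ : ℝ => (2 * Real.sqrt (1 - r^2 * Real.sin θ ^ 2)
      - (1 - r^2) * (1 / Real.sqrt (1 - r^2 * Real.sin θ ^ 2)))
      - (1 + r^2 * (Real.cos θ ^ 2 / (1 + Real.sqrt (1 - r^2 * Real.sin θ ^ 2))))) ?_
    (Continuous.intervalIntegrable (by fun_prop) _ _)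
  · rw [intervalIntegral.integral_sub, intervalIntegral.integral_sub, intervalIntegral.integral_add,
      intervalIntegral.integral_const_mul, intervalIntegral.integral_const_mul,
      intervalIntegral.integral_const_mul] at h
    · rw [hK]
      unfold ellipticE auxC
      simp at h ⊢
      linarith
    all_goals exact Continuous.intervalIntegrable (by fun_prop) _ _
  · intro θ _
    have hs0 := Real.sqrt_pos.2 (hD θ)
    have hsq := Real.sq_sqrt (hD θ).le
    have hi : HasDerivAt (fun θ : ℝ => 1 - r^2 * Real.sin θ ^ 2)
        (-(r^2 * (2 * Real.sin θ * Real.cos θ))) θ := by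
      have := ((((Real.hasDerivAt_sin θ).pow 2).const_mul (r^2)).const_sub 1)
      refine this.congr_deriv ?_
      norm_num
    have hq := (hi.sqrt (hD θ).ne').const_add 1
    have hn := ((Real.hasDerivAt_sin θ).mul (Real.hasDerivAt_cos θ)).const_mul (r^2)
    have hd := hn.div hq (auxC_den _ θ).ne'
    refine hd.congr_deriv ?_
    have hsc := Real.sin_sq_add_cos_sq θ
    symm
    rw [show (Real.sin * Real.cos) θ = Real.sin θ * Real.cos θ from rfl]
    generalize Real.sqrt (1 - r^2 * Real.sin θ ^ 2) = D at *
    generalize Real.sin θ = s at *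
    have hc2 : Real.cos θ ^ 2 = 1 - s ^ 2 := by linarith
    generalize Real.cos θ = c at *
    have h1 : 1 + D ≠ 0 := by positivity
    field_simp
    linear_combination (3 * D * (1 + D) - r^2 + r^2 * s^2 + (1 - D^2)) * hsq
      + (-2 * r^2 * D * (1 + D) - r^4 * s^2) * hc2

theorem aux_fun {r : ℝ} (hr : r ∈ Ioo (0:ℝ) 1) :
    (4 * (2 * ellipticE r - (1 - r^2) * ellipticK r)^2 - π^2) / r^2
      = 4 * π * auxC (r^2) + 4 * r^2 * auxC (r^2) ^ 2 := by
  rw [aux_key hr]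
  have := hr.1.ne'
  field_simp
  ring

theorem aux_cont_s8 : Continuous (fun r : ℝ => 4 * π * auxC (r^2) + 4 * r^2 * auxC (r^2) ^ 2) := by
  have := auxC_cont
  fun_prop

/-- Lemma 2.2(7): r ↦ [4(2E − r'²K)² − π²]/r² is strictly increasing from (0,1)
onto (π²/2, 16 − π²). -/
theorem stmt_8 :
    StrictMonoOn
      (fun r : ℝ => (4 * (2 * ellipticE r - (1 - r^2) * ellipticK r)^2 - π^2) / r^2)
      (Ioo 0 1) ∧
    Tendsto (fun r : ℝ => (4 * (2 * ellipticE r - (1 - r^2) * ellipticK r)^2 - π^2) / r^2)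
      (𝓝[>] 0) (𝓝 (π^2/2)) ∧
    Tendsto (fun r : ℝ => (4 * (2 * ellipticE r - (1 - r^2) * ellipticK r)^2 - π^2) / r^2)
      (𝓝[<] 1) (𝓝 (16 - π^2)) := by
  refine ⟨?_, ?_, ?_⟩
  · intro a ha b hb hab
    simp only []
    rw [aux_fun ha, aux_fun hb]
    have hab2 : a ^ 2 < b ^ 2 := by nlinarith [ha.1]
    have hb2 : b ^ 2 ≤ 1 := by nlinarith [hb.1, hb.2]
    have h := auxC_mono (sq_nonneg a) hab2 hb2
    have hp := auxC_pos (sq_nonneg a) (hab2.le.trans hb2)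
    have hpi := Real.pi_pos
    gcongr
  · have h := aux_cont_s8.tendsto 0
    have e : 4 * π * auxC ((0:ℝ)^2) + 4 * (0:ℝ)^2 * auxC ((0:ℝ)^2) ^ 2 = π^2/2 := by
      norm_num [auxC_zero]
      ring
    rw [e] at h
    refine (h.mono_left nhdsWithin_le_nhds).congr' ?_
    filter_upwards [Ioo_mem_nhdsGT (zero_lt_one' ℝ)] with r hr
    exact (aux_fun hr).symm
  · have h := aux_cont_s8.tendsto 1
    have e : 4 * π * auxC ((1:ℝ)^2) + 4 * (1:ℝ)^2 * auxC ((1:ℝ)^2) ^ 2 = 16 - π^2 := by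
      norm_num [auxC_one]
      ring
    rw [e] at h
    refine (h.mono_left nhdsWithin_le_nhds).congr' ?_
    filter_upwards [Ioo_mem_nhdsLT (zero_lt_one' ℝ)] with r hr
    exact (aux_fun hr).symm
end
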